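/- For a general surface S_14 ⊂ P^5 (a general isomorphic projection to P^5 of the degree-8, sectional genus-3 smooth surface in P^6 that is the image of P^2 under quartic plane curves with 8 general base points), the space H^0(I²_{S_14}(5)) of quintic forms on P^5 vanishing to order at least 2 along S_14 has dimension 5, so |H^0(I²_{S_14}(5))| = P^4. -/

import Mathlib

/-!
Common framework: a set-theoretic model of complex projective algebraic
geometry in `ℙⁿ = Projectivization ℂ (Fin (n+1) → ℂ)`, sufficient to state
the results of Russo–Stagliano, "Explicit rationality of some cubic fourfolds".
-/

noncomputable section
open MvPolynomial Filter Set
open scoped Classical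

namespace CF

/-- Polynomials in `n` variables over `ℂ` (forms on `ℙ^(n-1)` when homogeneous). -/
abbrev Pl (n : ℕ) := MvPolynomial (Fin n) ℂ

/-- Complex projective `n`-space. -/
abbrev Pr (n : ℕ) := Projectivization ℂ (Fin (n + 1) → ℂ)

/-- The affine cone (set of nonzero representative vectors) over a subset of `ℙⁿ`. -/
def cone {n : ℕ} (Z : Set (Pr n)) : Set (Fin (n + 1) → ℂ) :=
  {v | ∃ h : v ≠ 0, Projectivization.mk ℂ v h ∈ Z}

/-- The common zero locus in `ℙⁿ` of a set of polynomials. -/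
def zeroSet {n : ℕ} (T : Set (Pl (n + 1))) : Set (Pr n) :=
  {x | ∀ f ∈ T, ∀ v ∈ cone ({x} : Set (Pr n)), eval v f = 0}

/-- Zariski-closed (algebraic) subsets of `ℙⁿ`. -/
def IsAlg {n : ℕ} (Z : Set (Pr n)) : Prop :=
  ∃ T : Set (Pl (n + 1)), (∀ f ∈ T, ∃ d, f.IsHomogeneous d) ∧ Z = zeroSet T

/-- Zariski closure. -/
def algClosure {n : ℕ} (A : Set (Pr n)) : Set (Pr n) := ⋂₀ {Z | IsAlg Z ∧ A ⊆ Z}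

/-- `A` is a (Zariski-)dense subset of `X`. -/
def DenseIn {n : ℕ} (A X : Set (Pr n)) : Prop := A ⊆ X ∧ X ⊆ algClosure A

/-- Irreducibility with respect to the Zariski topology. -/
def IsIrr {n : ℕ} (X : Set (Pr n)) : Prop :=
  X.Nonempty ∧ ∀ Z₁ Z₂ : Set (Pr n), IsAlg Z₁ → IsAlg Z₂ → X ⊆ Z₁ ∪ Z₂ → (X ⊆ Z₁ ∨ X ⊆ Z₂)

/-- Dimension of `X`: Krull dimension of the poset of irreducible algebraic
subsets of `X`. -/
def dim {n : ℕ} (X : Set (Pr n)) : WithBot ℕ∞ :=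
  Order.krullDim {W : Set (Pr n) // IsAlg W ∧ IsIrr W ∧ W ⊆ X}

/-- The (saturated) homogeneous vanishing ideal of `Z ⊆ ℙⁿ`. -/
def vIdeal {n : ℕ} (Z : Set (Pr n)) : Ideal (Pl (n + 1)) :=
  ⨅ v ∈ cone Z, RingHom.ker (MvPolynomial.eval v)

/-- Hilbert function of a homogeneous ideal: dimension of the degree `d` graded
piece of the quotient ring. -/
def hilb {n : ℕ} (I : Ideal (Pl n)) (d : ℕ) : ℕ :=
  Module.finrank ℂ
    ((homogeneousSubmodule (Fin n) ℂ d).map (Ideal.Quotient.mkₐ ℂ I).toLinearMap)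

/-- A finite scheme cut out by a homogeneous ideal `I` has length `L`
(the eventual value of the Hilbert function). -/
def HasLen {n : ℕ} (I : Ideal (Pl n)) (L : ℕ) : Prop := ∀ᶠ d in atTop, hilb I d = L

/-- The scheme-theoretic intersection `C ∩ S` has length `L`. -/
def interLength {n : ℕ} (C S : Set (Pr n)) (L : ℕ) : Prop := HasLen (vIdeal C ⊔ vIdeal S) L

/-- `Z` has Hilbert polynomial `p`. -/
def HasHilbPoly {n : ℕ} (Z : Set (Pr n)) (p : Polynomial ℚ) : Prop :=
  ∀ᶠ d in atTop, (hilb (vIdeal Z) d : ℚ) = p.eval (d : ℚ)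

/-- `Z` is `k`-dimensional of degree `e` (leading term `e·dᵏ/k!` of the
Hilbert polynomial). -/
def HasDegree {n : ℕ} (Z : Set (Pr n)) (k e : ℕ) : Prop :=
  ∃ p : Polynomial ℚ, HasHilbPoly Z p ∧ p.natDegree ≤ k ∧
    p.coeff k = (e : ℚ) / (Nat.factorial k)

/-- A curve `C` has degree `e` (Hilbert polynomial `e·d + c`). -/
def CurveDeg {n : ℕ} (C : Set (Pr n)) (e : ℕ) : Prop :=
  ∃ c : ℤ, ∀ᶠ d in atTop, (hilb (vIdeal C) d : ℤ) = e * d + c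

/-- A curve `C` has degree `e` and arithmetic genus `g`
(Hilbert polynomial `e·d + 1 - g`). -/
def CurveDegGenus {n : ℕ} (C : Set (Pr n)) (e : ℕ) (g : ℤ) : Prop :=
  ∀ᶠ d in atTop, (hilb (vIdeal C) d : ℤ) = e * d + 1 - g

/-- Iterated partial derivative operator. -/
def diffOp {n : ℕ} (l : List (Fin n)) : Pl n →ₗ[ℂ] Pl n :=
  l.foldr (fun i L => L ∘ₗ (pderiv i).toLinearMap) LinearMap.id

/-- The vector space of degree-`d` forms in `n` variables vanishing to order
`≥ e` at every point of a set `A` of vectors. -/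
def linSysV (n d e : ℕ) (A : Set (Fin n → ℂ)) : Submodule ℂ (Pl n) :=
  homogeneousSubmodule (Fin n) ℂ d ⊓
    ⨅ (l : List (Fin n)) (_ : l.length < e) (v : Fin n → ℂ) (_ : v ∈ A),
      LinearMap.ker ((aeval (R := ℂ) v).toLinearMap ∘ₗ diffOp l)

/-- `H⁰(𝐼_Z^e(d))`: degree-`d` forms with points of multiplicity `≥ e` along
`Z ⊆ ℙⁿ`. -/
def linSys {n : ℕ} (d e : ℕ) (Z : Set (Pr n)) : Submodule ℂ (Pl (n + 1)) :=
  linSysV (n + 1) d e (cone Z)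

/-- `h⁰(𝐼_Z^e(d))`. -/
def h0 {n : ℕ} (d e : ℕ) (Z : Set (Pr n)) : ℕ := Module.finrank ℂ ↥(linSys d e Z)

/-- A base point of projective space. -/
def Pr.pt (m : ℕ) : Pr m :=
  Projectivization.mk ℂ (fun _ => (1 : ℂ)) (fun h => one_ne_zero (congrFun h 0))

/-- A rational map `ℙⁿ ⇢ ℙᵐ` given by `m+1` forms of the same degree. -/
structure RatMap (n m : ℕ) where
  F : Fin (m + 1) → Pl (n + 1)
  deg : ℕ
  homog : ∀ i, (F i).IsHomogeneous deg
  nontriv : ∃ x : Pr n, (fun i => eval x.rep (F i)) ≠ 0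

/-- Locus where a rational map is defined. -/
def RatMap.dom {n m : ℕ} (φ : RatMap n m) : Set (Pr n) :=
  {x | (fun i => eval x.rep (φ.F i)) ≠ 0}

/-- The underlying (partial) function of a rational map. -/
def RatMap.app {n m : ℕ} (φ : RatMap n m) (x : Pr n) : Pr m :=
  if h : (fun i => eval x.rep (φ.F i)) ≠ 0 then Projectivization.mk ℂ _ h else Pr.pt m

/-- `b` is a basis of the subspace `W`. -/
def IsBasisOf {M : Type*} [AddCommGroup M] [Module ℂ M] {k : ℕ}
    (b : Fin k → M) (W : Submodule ℂ M) : Prop :=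
  (∀ i, b i ∈ W) ∧ LinearIndependent ℂ b ∧ Submodule.span ℂ (Set.range b) = W

/-- The rational map `φ` is defined by (a basis of) the linear system `W`. -/
def RatMap.definedBy {n m : ℕ} (φ : RatMap n m) (W : Submodule ℂ (Pl (n + 1))) : Prop :=
  IsBasisOf φ.F W

/-- `f` restricts to a birational map from `X` onto `Y`:
it is a bijection between dense subsets. -/
def BirationalOn {n m : ℕ} (f : Pr n → Pr m) (X : Set (Pr n)) (Y : Set (Pr m)) : Prop :=
  ∃ U V, DenseIn U X ∧ DenseIn V Y ∧ Set.BijOn f U V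

/-- Closure of the image of `X` under the rational map `φ`. -/
def RatMap.im {n m : ℕ} (φ : RatMap n m) (X : Set (Pr n)) : Set (Pr m) :=
  algClosure (φ.app '' (X ∩ φ.dom))

/-- `X ⊆ ℙⁿ` is rational of dimension `k`: birational to `ℙᵏ`. -/
def Rational {n : ℕ} (X : Set (Pr n)) (k : ℕ) : Prop :=
  ∃ φ : RatMap n k, BirationalOn φ.app X Set.univ

/-- `Q` holds generically (off a proper algebraic subset) on `X`. -/
def Generically {n : ℕ} (X : Set (Pr n)) (Q : Pr n → Prop) : Prop :=
  ∃ Z, IsAlg Z ∧ ¬ X ⊆ Z ∧ ∀ x ∈ X \ Z, Q x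

/-- `Q` holds for a generic choice of affine parameters indexed by `ι`. -/
def GenericAff {ι : Type} (Q : ((ι → ℂ)) → Prop) : Prop :=
  ∃ P : MvPolynomial ι ℂ, P ≠ 0 ∧ ∀ v, eval v P ≠ 0 → Q v

/-- Polynomial functions on a complex vector space. -/
def polyFun (V : Type*) [AddCommGroup V] [Module ℂ V] : Subalgebra ℂ (V → ℂ) :=
  Algebra.adjoin ℂ (Set.range fun φ : Module.Dual ℂ V => (φ : V → ℂ))

/-- `Q` holds generically on the subset `A` of a complex vector space
(on a nonempty "open" subset cut by nonvanishing of a polynomial function). -/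
def GenericallyLin {V : Type*} [AddCommGroup V] [Module ℂ V]
    (A : Set V) (Q : V → Prop) : Prop :=
  ∃ P : V → ℂ, P ∈ polyFun V ∧ (∃ v ∈ A, P v ≠ 0) ∧ ∀ v ∈ A, P v ≠ 0 → Q v

/-- Zariski-closed subsets of a complex vector space. -/
def AffClosed {V : Type*} [AddCommGroup V] [Module ℂ V] (Z : Set V) : Prop :=
  ∃ T : Set (V → ℂ), (∀ f ∈ T, f ∈ polyFun V) ∧ Z = {v | ∀ f ∈ T, f v = 0}

/-- Zariski closure in a complex vector space. -/
def affClosure {V : Type*} [AddCommGroup V] [Module ℂ V] (A : Set V) : Set V :=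
  ⋂₀ {Z | AffClosed Z ∧ A ⊆ Z}

/-- The projective hypersurface `F = 0` is smooth. -/
def SmoothHypersurface {n : ℕ} (F : Pl (n + 1)) : Prop :=
  ∀ v : Fin (n + 1) → ℂ, v ≠ 0 → ¬ (∀ i, eval v (pderiv i F) = 0)

/-- Embedded (projective) tangent space of `X` at `x`. -/
def tangentSpaceAt {n : ℕ} (X : Set (Pr n)) (x : Pr n) : Set (Pr n) :=
  {y | ∀ f ∈ vIdeal X, (∑ i, y.rep i * eval x.rep (pderiv i f)) = 0}

/-- `X` is a smooth subvariety (tangent space has the right dimension at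
every point). -/
def SmoothVariety {n : ℕ} (X : Set (Pr n)) : Prop :=
  IsAlg X ∧ ∀ x ∈ X, dim (tangentSpaceAt X x) = dim X

/-- Lines in `ℙⁿ`. -/
def IsLine {n : ℕ} (L : Set (Pr n)) : Prop :=
  ∃ A : (Fin 2 → ℂ) →ₗ[ℂ] (Fin (n + 1) → ℂ), Function.Injective A ∧
    L = {x | ∃ (v : Fin 2 → ℂ) (h : A v ≠ 0), x = Projectivization.mk ℂ (A v) h}

/-- Conics in `ℙ⁵`: irreducible plane quadrics. -/
def IsConic (C : Set (Pr 5)) : Prop :=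
  ∃ A : (Fin 3 → ℂ) →ₗ[ℂ] (Fin 6 → ℂ), Function.Injective A ∧
    ∃ q : Pl 3, q.IsHomogeneous 2 ∧ q ≠ 0 ∧
      C = {x | ∃ (v : Fin 3 → ℂ) (h : A v ≠ 0),
        eval v q = 0 ∧ x = Projectivization.mk ℂ (A v) h}

/-- Standard rational normal cubic parametrization of `ℙ¹` in `ℙ³`. -/
def twistedParam (s : Fin 2 → ℂ) : Fin 4 → ℂ :=
  ![s 0 ^ 3, s 0 ^ 2 * s 1, s 0 * s 1 ^ 2, s 1 ^ 3]

/-- Twisted cubics in `ℙ⁵` (rational normal curves of degree 3). -/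
def IsTwistedCubic (C : Set (Pr 5)) : Prop :=
  ∃ A : (Fin 4 → ℂ) →ₗ[ℂ] (Fin 6 → ℂ), Function.Injective A ∧
    C = {x | ∃ (s : Fin 2 → ℂ) (h : A (twistedParam s) ≠ 0),
      x = Projectivization.mk ℂ (A (twistedParam s)) h}

/-- Secant variety of `Z ⊆ ℙⁿ`. -/
def secantVariety {n : ℕ} (Z : Set (Pr n)) : Set (Pr n) :=
  algClosure {y | ∃ u v : Fin (n + 1) → ℂ, u ∈ cone Z ∧ v ∈ cone Z ∧
    y.rep ∈ Submodule.span ℂ ({u, v} : Set (Fin (n + 1) → ℂ))}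

/-- Closure of the image of the rational map `ℙ^(m-1) ⇢ ℙⁿ` given by the
polynomials `b i`. -/
def imClos {m n : ℕ} (b : Fin (n + 1) → Pl m) : Set (Pr n) :=
  algClosure {x | ∃ (v : Fin m → ℂ) (h : (fun i => eval v (b i)) ≠ 0),
    x = Projectivization.mk ℂ _ h}

/-- The (partial) map on projective spaces induced by a linear map. -/
def projPt {N n : ℕ} (L : (Fin (N + 1) → ℂ) →ₗ[ℂ] (Fin (n + 1) → ℂ)) (x : Pr N) : Pr n :=
  if h : L x.rep ≠ 0 then Projectivization.mk ℂ (L x.rep) h else Pr.pt n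

/-- Closure of the image of `Z` under the linear projection induced by `L`. -/
def projIm {N n : ℕ} (L : (Fin (N + 1) → ℂ) →ₗ[ℂ] (Fin (n + 1) → ℂ))
    (Z : Set (Pr N)) : Set (Pr n) :=
  algClosure {y | ∃ v ∈ cone Z, ∃ h : L v ≠ 0, y = Projectivization.mk ℂ (L v) h}

/-- Double points (images of at least two points of `Z`) of the projection. -/
def doublePoints {N n : ℕ} (L : (Fin (N + 1) → ℂ) →ₗ[ℂ] (Fin (n + 1) → ℂ))
    (Z : Set (Pr N)) : Set (Pr n) :=
  {y | ∃ x₁ x₂, x₁ ∈ Z ∧ x₂ ∈ Z ∧ x₁ ≠ x₂ ∧ projPt L x₁ = y ∧ projPt L x₂ = y}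

/-- Linear map from a matrix of parameters. -/
def matLin {p q : ℕ} (M : Fin p × Fin q → ℂ) : (Fin q → ℂ) →ₗ[ℂ] (Fin p → ℂ) :=
  Matrix.mulVecLin (Matrix.of fun i j => M (i, j))

/-- Linear form with coefficient vector `c`. -/
def linForm {m : ℕ} (c : Fin m → ℂ) : Pl m := ∑ i, C (c i) * X i

/-- Parametrization of the rational normal scroll `S(a,b)`. -/
def scrollVec (a b : ℕ) {n : ℕ} (v : Fin 4 → ℂ) : Fin (n + 1) → ℂ := fun i =>
  if i.val ≤ a then v 2 * v 0 ^ (a - i.val) * v 1 ^ i.val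
  else v 3 * v 0 ^ (a + b + 1 - i.val) * v 1 ^ (i.val - (a + 1))

/-- The standard rational normal scroll `S(a,b) ⊆ ℙⁿ` (`n = a + b + 1`). -/
def stdScroll (a b n : ℕ) : Set (Pr n) :=
  {x | ∃ (v : Fin 4 → ℂ) (h : scrollVec a b (n := n) v ≠ 0),
    x = Projectivization.mk ℂ _ h}

/-- Smooth rational normal scroll surfaces of degree `d` in `ℙⁿ = ℙ^(d+1)`. -/
def IsRNScroll (d : ℕ) {n : ℕ} (S : Set (Pr n)) : Prop :=
  ∃ a b : ℕ, 1 ≤ a ∧ 1 ≤ b ∧ a + b = d ∧ a + b + 1 = n ∧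
    ∃ g : (Fin (n + 1) → ℂ) ≃ₗ[ℂ] (Fin (n + 1) → ℂ),
      S = Projectivization.map (g : (Fin (n+1) → ℂ) →ₗ[ℂ] (Fin (n+1) → ℂ)) g.injective ''
        stdScroll a b n
/-- The 10 ordered pairs `i < j` in `Fin 5`. -/
def pairs4 : Fin 10 → Fin 5 × Fin 5 :=
  ![(0,1),(0,2),(0,3),(0,4),(1,2),(1,3),(1,4),(2,3),(2,4),(3,4)]

/-- Plücker coordinates of the line spanned by `u, v` in `ℙ⁴`. -/
def pluck4 (u v : Fin 5 → ℂ) : Fin 10 → ℂ := fun p =>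
  u (pairs4 p).1 * v (pairs4 p).2 - u (pairs4 p).2 * v (pairs4 p).1

/-- The Grassmannian `𝔾(1,4) ⊆ ℙ⁹` of lines in `ℙ⁴`, Plücker embedded. -/
def G14 : Set (Pr 9) :=
  {x | ∃ (u v : Fin 5 → ℂ) (h : pluck4 u v ≠ 0), x = Projectivization.mk ℂ (pluck4 u v) h}

/-- The 15 ordered pairs `i < j` in `Fin 6`. -/
def pairs5 : Fin 15 → Fin 6 × Fin 6 :=
  ![(0,1),(0,2),(0,3),(0,4),(0,5),(1,2),(1,3),(1,4),(1,5),(2,3),(2,4),(2,5),(3,4),(3,5),(4,5)]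

/-- Plücker coordinates of the line spanned by `u, v` in `ℙ⁵`. -/
def pluck5 (u v : Fin 6 → ℂ) : Fin 15 → ℂ := fun p =>
  u (pairs5 p).1 * v (pairs5 p).2 - u (pairs5 p).2 * v (pairs5 p).1

/-- The Grassmannian `𝔾(1,5) ⊆ ℙ¹⁴` of lines in `ℙ⁵`, Plücker embedded. -/
def G15 : Set (Pr 14) :=
  {x | ∃ (u v : Fin 6 → ℂ) (h : pluck5 u v ≠ 0), x = Projectivization.mk ℂ (pluck5 u v) h}

/-- `Y ⊆ ℙⁿ` is (projectively equivalent to) a linear section of `G ⊆ ℙᴺ`. -/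
def IsLinearSectionOf {n N : ℕ} (Y : Set (Pr n)) (G : Set (Pr N)) : Prop :=
  ∃ (J : (Fin (n + 1) → ℂ) →ₗ[ℂ] (Fin (N + 1) → ℂ)) (hJ : Function.Injective J),
    Projectivization.map (J : (Fin (n+1) → ℂ) →ₗ[ℂ] (Fin (N+1) → ℂ)) hJ '' Y =
      G ∩ Set.range (Projectivization.map (J : (Fin (n+1) → ℂ) →ₗ[ℂ] (Fin (N+1) → ℂ)) hJ)

/-! ### The surfaces `S_d ⊆ ℙ⁵` -/

/-- The surface `S₁₄ ⊆ ℙ⁵`: isomorphic projection to `ℙ⁵` of the smooth octic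
surface of sectional genus 3 in `ℙ⁶`, image of `ℙ²` by the quartics through
the 8 points `pts`.  `b` is a basis of that system of quartics and the center
of the projection `L` avoids the secant variety. -/
def IsS14 (pts : Fin 8 → (Fin 3 → ℂ)) (S : Set (Pr 5)) : Prop :=
  ∃ b : Fin 7 → Pl 3, IsBasisOf b (linSysV 3 4 1 (Set.range pts)) ∧
    ∃ L : (Fin 7 → ℂ) →ₗ[ℂ] (Fin 6 → ℂ), Function.Surjective L ∧
      (∀ v ∈ cone (secantVariety (imClos (n := 6) b)), L v ≠ 0) ∧
      S = projIm L (imClos (n := 6) b)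

/-- The surface `S₃₈ ⊆ ℙ⁵`: image of `ℙ²` by the linear system of curves of
degree 10 with 10 triple points at `pts`. -/
def IsS38 (pts : Fin 10 → (Fin 3 → ℂ)) (S : Set (Pr 5)) : Prop :=
  ∃ b : Fin 6 → Pl 3, IsBasisOf b (linSysV 3 10 3 (Set.range pts)) ∧ S = imClos (n := 5) b

/-- Farkas–Verra surfaces: rational septic scrolls in `ℙ⁵` with 3 nodes,
projections of a rational normal septic scroll in `ℙ⁸`. -/
def IsFVScroll (S : Set (Pr 5)) : Prop :=
  ∃ Sc : Set (Pr 8), IsRNScroll 7 Sc ∧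
    ∃ L : (Fin 9 → ℂ) →ₗ[ℂ] (Fin 6 → ℂ), Function.Surjective L ∧
      (∀ v ∈ cone Sc, L v ≠ 0) ∧ S = projIm L Sc ∧
      (doublePoints L Sc).ncard = 3 ∧
      (∀ y ∈ doublePoints L Sc, ({x | x ∈ Sc ∧ projPt L x = y}).ncard = 2)

/-- Smooth del Pezzo surfaces of degree 7 in `ℙ⁷`: images of `ℙ²` by the cubics
through two distinct points. -/
def IsDelPezzo7 (S : Set (Pr 7)) : Prop :=
  ∃ p : Fin 2 → (Fin 3 → ℂ), (∀ i, p i ≠ 0) ∧ (∀ c : ℂ, p 0 ≠ c • p 1) ∧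
    ∃ b : Fin 8 → Pl 3, IsBasisOf b (linSysV 3 3 1 (Set.range p)) ∧ S = imClos (n := 7) b

/-- Octic rational scrolls `S'₃₈ ⊆ ℙ⁵` with exactly 6 nodes (`Nodes`), obtained
by projecting a smooth octic rational normal scroll in `ℙ⁹` from a `ℙ³`
meeting its secant variety in 6 points. -/
def IsS38'Nodes (S Nodes : Set (Pr 5)) : Prop :=
  ∃ Sc : Set (Pr 9), IsRNScroll 8 Sc ∧
    ∃ L : (Fin 10 → ℂ) →ₗ[ℂ] (Fin 6 → ℂ), Function.Surjective L ∧
      (∀ v ∈ cone Sc, L v ≠ 0) ∧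
      ({x | x ∈ secantVariety Sc ∧ L x.rep = 0}).ncard = 6 ∧
      S = projIm L Sc ∧ Nodes = doublePoints L Sc ∧ Nodes.ncard = 6 ∧
      (∀ y ∈ Nodes, ({x | x ∈ Sc ∧ projPt L x = y}).ncard = 2)

/-- Octic rational scrolls in `ℙ⁵` with 6 nodes. -/
def IsS38' (S : Set (Pr 5)) : Prop := ∃ Nodes, IsS38'Nodes S Nodes

/-- Smooth quintic del Pezzo surfaces `D ⊆ ℙ⁵`: images of `ℙ²` by the cubics
through 4 points in general position. -/
def IsQuinticDelPezzo (D : Set (Pr 5)) : Prop :=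
  ∃ p : Fin 4 → (Fin 3 → ℂ),
    (∀ i j k : Fin 4, i ≠ j → j ≠ k → i ≠ k → LinearIndependent ℂ ![p i, p j, p k]) ∧
    ∃ b : Fin 6 → Pl 3, IsBasisOf b (linSysV 3 3 1 (Set.range p)) ∧ D = imClos (n := 5) b

/-! ### Hassett divisors (via their geometric descriptions) -/

/-- Cubic forms whose zero locus contains a surface of the prescribed kind. -/
def cubicsContaining (P : Set (Pr 5) → Prop) : Set (Pl 6) :=
  {F | F.IsHomogeneous 3 ∧ ∃ S, P S ∧ S ⊆ zeroSet {F}}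

/-- The "divisor" of cubic forms: Zariski closure (within the cubics) of the
locus of cubics containing a surface of the prescribed kind. -/
def HassettDiv (P : Set (Pr 5) → Prop) : Set (Pl 6) :=
  affClosure (cubicsContaining P) ∩ {F | F.IsHomogeneous 3}

/-- The Hassett divisor `𝒞₁₄` (cubics containing a quintic del Pezzo surface). -/
def HassettC14 : Set (Pl 6) := HassettDiv IsQuinticDelPezzo

/-- The Hassett divisor `𝒞₂₆` (cubics containing a Farkas–Verra
3-nodal septic scroll). -/
def HassettC26 : Set (Pl 6) := HassettDiv IsFVScroll

/-- The Hassett divisor `𝒞₃₈` (cubics containing a surface `S₃₈`). -/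
def HassettC38 : Set (Pl 6) :=
  HassettDiv fun S => ∃ pts : Fin 10 → (Fin 3 → ℂ), (∀ i, pts i ≠ 0) ∧ IsS38 pts S

/-! ### Congruences of `(re-1)`-secant curves of degree `e` -/

/-- A congruence of `(r·e-1)`-secant curves of degree `e` to a surface
`S ⊆ ℙ⁵`: an irreducible proper 4-dimensional family `H` of degree-`e` curves,
whose general member is irreducible and meets `S` in a scheme of length
`r·e - 1`, and such that through a general point of `ℙ⁵` there passes exactly
one member (i.e. the tautological morphism `ψ : 𝒟 → ℙ⁵` is birational). -/
structure Congruence (S : Set (Pr 5)) (e r : ℕ) where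
  N : ℕ
  H : Set (Pr N)
  H_alg : IsAlg H
  H_irr : IsIrr H
  H_dim : dim H = 4
  curve : Pr N → Set (Pr 5)
  curve_alg : ∀ h ∈ H, IsAlg (curve h)
  curve_dim : ∀ h ∈ H, dim (curve h) = 1
  curve_deg : ∀ h ∈ H, CurveDeg (curve h) e
  curve_irr : Generically H fun h => IsIrr (curve h)
  secant : Generically H fun h => interLength (curve h) S (r * e - 1)
  unique_through : Generically Set.univ fun x : Pr 5 => ∃! h, h ∈ H ∧ x ∈ curve h

/-- The hypersurface `X` is transversal to the congruence: the unique member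
through a general point of `X` is not contained in `X`. -/
def TransversalTo {S : Set (Pr 5)} {e r : ℕ} (X : Set (Pr 5)) (𝒞 : Congruence S e r) : Prop :=
  Generically X fun x =>
    (∃ h, h ∈ 𝒞.H ∧ x ∈ 𝒞.curve h) ∧
    ∀ h, h ∈ 𝒞.H → x ∈ 𝒞.curve h → ¬ (𝒞.curve h ⊆ X)

/-! ### Sections of (co)normal sheaves, via graded homomorphisms -/

/-- Global sections of the normal sheaf `N_{S/ℙⁿ}`, modelled as degree-0 graded
homomorphisms `I → R/I` of graded modules over the coordinate ring. -/
def gradedHomDeg0 {n : ℕ} (I : Ideal (Pl n)) :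
    Submodule ℂ (↥I →ₗ[Pl n] (Pl n ⧸ I)) where
  carrier := {φ | ∀ (d : ℕ) (f : Pl n) (hf : f ∈ I), f.IsHomogeneous d →
      ∃ g : Pl n, g.IsHomogeneous d ∧ φ ⟨f, hf⟩ = Ideal.Quotient.mk I g}
  add_mem' := by
    rintro φ ψ hφ hψ d f hf hdf
    obtain ⟨g1, hg1, e1⟩ := hφ d f hf hdf
    obtain ⟨g2, hg2, e2⟩ := hψ d f hf hdf
    exact ⟨g1 + g2, hg1.add hg2, by simp [e1, e2]⟩
  zero_mem' := by
    intro d f hf hdf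
    exact ⟨0, isHomogeneous_zero _ _ _, by simp⟩
  smul_mem' := by
    rintro c φ hφ d f hf hdf
    obtain ⟨g, hg, e⟩ := hφ d f hf hdf
    refine ⟨c • g, ?_, ?_⟩
    · rw [smul_eq_C_mul]
      simpa using (isHomogeneous_C (Fin n) c).mul hg
    · have : Ideal.Quotient.mk I (c • g) = c • Ideal.Quotient.mk I g :=
        map_smul (Ideal.Quotient.mkₐ ℂ I) c g
      simp [e, this]

/-- Evaluation of a graded homomorphism at an element of the ideal. -/
def evalAt {n : ℕ} (I : Ideal (Pl n)) (f : ↥I) :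
    (↥I →ₗ[Pl n] (Pl n ⧸ I)) →ₗ[ℂ] (Pl n ⧸ I) where
  toFun φ := φ f
  map_add' := by intros; rfl
  map_smul' := by intros; rfl

/-- `h⁰(N_{S/ℙⁿ})` for `S ⊆ ℙⁿ` with homogeneous ideal `I`. -/
def h0Normal {n : ℕ} (I : Ideal (Pl n)) : ℕ := Module.finrank ℂ ↥(gradedHomDeg0 I)

/-- `h⁰(N_{S/X})` for `S ⊆ X = {F = 0} ⊆ ℙⁿ`: those sections of `N_{S/ℙⁿ}`
killing the equation of `X`. -/
def h0NormalIn {n : ℕ} (I : Ideal (Pl n)) (F : Pl n) (hF : F ∈ I) : ℕ :=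
  Module.finrank ℂ ↥(gradedHomDeg0 I ⊓ LinearMap.ker (evalAt I ⟨F, hF⟩))

/-- `h⁰(N^*_{S/ℙ⁵}(k))`, modelled as the dimension of the image of
`H⁰(𝐼_S(k)) → H⁰(N^*_{S/ℙ⁵}(k))`, i.e. of `H⁰(𝐼_S(k))/H⁰(𝐼_S²(k))`. -/
def h0conormal (S : Set (Pr 5)) (k : ℕ) : ℕ :=
  Module.finrank ℂ ↥((linSys k 1 S).map (linSys (n := 5) k 2 S).mkQ)

/-! ### Rational singularities (proxy) and projective degrees -/

/-- `X ⊆ ℙ⁵` has at worst rational singularities: it admits a resolution of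
singularities `f : X' → X` (a smooth projective variety mapping regularly and
birationally onto `X`) inducing an equality of the Euler characteristics
`χ(𝒪_{X'}) = χ(𝒪_X)` (constant terms of the Hilbert polynomials). -/
def HasAtWorstRationalSingularities (X : Set (Pr 5)) : Prop :=
  ∃ (N : ℕ) (X' : Set (Pr N)) (f : Pr N → Pr 5),
    IsAlg X' ∧ IsIrr X' ∧ SmoothVariety X' ∧
    (∀ x ∈ X', ∃ φ : RatMap N 5, x ∈ φ.dom ∧ ∀ y ∈ X' ∩ φ.dom, f y = φ.app y) ∧
    f '' X' = X ∧ BirationalOn f X' X ∧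
    ∃ p q : Polynomial ℚ, HasHilbPoly X' p ∧ HasHilbPoly X q ∧
      p.eval 0 = q.eval 0

/-- The `i`-th projective degree of (the restriction to `X`, of dimension
`dimX`, of) the map `f` with domain of definition `dom`: the degree of the
closure of the preimage of a general linear subspace of codimension `i` of the
target `ℙᵐ`. -/
def HasProjDeg {m : ℕ} (f : Pr 5 → Pr m) (dom X : Set (Pr 5)) (dimX i di : ℕ) : Prop :=
  GenericAff (ι := Fin i × Fin (m + 1)) fun P =>
    HasDegree
      (algClosure (X ∩ dom ∩ f ⁻¹'
        (zeroSet {g | ∃ j : Fin i, g = linForm fun t => P (j, t)})))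
      (dimX - i) di

/-! ### Certified Gaussian elimination modulo a prime -/

/-- `f x`, arranged so that evaluation first reduces `x` to a literal. -/
def force {β : Type} (x : ℕ) (f : ℕ → β) : β :=
  Nat.rec (f 0) (fun n _ => f n) (Nat.add x 1)

theorem force_eq {β : Type} (x : ℕ) (f : ℕ → β) : force x f = f x := rfl

/-- `k (l.map g)`, with all entries of `l.map g` reduced to literals first. -/
def forceMap {α β : Type} (g : α → ℕ) (l : List α) : (List ℕ → β) → β :=
  List.rec (fun k => k []) (fun a _ ih k => force (g a) fun b => ih fun bs => k (b :: bs)) l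

theorem forceMap_eq {α β : Type} (g : α → ℕ) (l : List α) (k : List ℕ → β) :
    forceMap g l k = k (l.map g) := by
  induction l generalizing k with
  | nil => rfl
  | cons a l ih => exact ih fun bs => k (g a :: bs)

/-- The number with base-`X` digits `g a`, for `a` in `l`. -/
def pack {α : Type} (X : ℕ) (g : α → ℕ) (l : List α) : ℕ :=
  List.rec 0 (fun a _ ih => Nat.add (g a) (Nat.mul X ih)) l

theorem pack_cons {α : Type} (X : ℕ) (g : α → ℕ) (a : α) (l : List α) :
    pack X g (a :: l) = g a + X * pack X g l := rfl

theorem pack_map {α γ : Type} (X : ℕ) (g : α → ℕ) (f : γ → α) (l : List γ) :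
    pack X g (l.map f) = pack X (g ∘ f) l := by
  induction l with
  | nil => rfl
  | cons a l ih => rw [List.map_cons, pack_cons, pack_cons, ih]; rfl

/-- Multiply the lowest `n` base-`X` digits by `c`, and reduce them modulo `p`. -/
def scaleRow (p X c n : ℕ) : ℕ → ℕ :=
  Nat.rec (fun _ => 0) (fun _ ih t => force (Nat.div t X) fun t' =>
    Nat.add (Nat.mod (Nat.mul (Nat.mod t X) c) p) (Nat.mul X (ih t'))) n

theorem scaleRow_succ (p X c n t : ℕ) :
    scaleRow p X c (n + 1) t = t % X * c % p + X * scaleRow p X c n (t / X) := rfl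

/-- Gaussian elimination modulo `p` on an `n × n` matrix whose rows are packed in base `X`;
the result is `true` if all the pivots occur on the diagonal. -/
def elim (p X n : ℕ) : List ℕ → Bool :=
  Nat.rec (fun _ => true) (fun n ih rows => List.rec false (fun r rs _ =>
    force (scaleRow p X (Nat.mod (Nat.pow (Nat.mod (Nat.mod r X) p) (Nat.sub p 2)) p) (Nat.succ n) r)
      fun u =>
      Bool.rec false
        (forceMap (fun t => Nat.div (Nat.add t (Nat.mul (Nat.sub p (Nat.mod (Nat.mod t X) p)) u)) X)
          rs ih)
        (Nat.beq (Nat.mod u X) 1)) rows) n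

theorem elim_succ_cons {p X n r : ℕ} {rs : List ℕ} (h : elim p X (n + 1) (r :: rs) = true) :
    ∃ c, scaleRow p X c (n + 1) r % X = 1 ∧
      elim p X n (rs.map fun t => (t + (p - t % X % p) * scaleRow p X c (n + 1) r) / X) = true := by
  refine ⟨(r % X % p) ^ (p - 2) % p, ?_⟩
  change (Bool.rec false (forceMap _ rs (elim p X n)) (Nat.beq _ 1) : Bool) = true at h
  rw [forceMap_eq] at h
  generalize hb : Nat.beq _ 1 = b at h
  cases b with
  | false => simp at h
  | true => exact ⟨Nat.eq_of_beq_eq_true hb, h⟩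

section
variable {p X : ℕ}

/-- `T` has base-`X` digits at most `B`, whose dot product with `x` modulo `p` is `s`. -/
def PackedDot (p X B : ℕ) : List (ZMod p) → ℕ → ZMod p → Prop
  | [], T, s => T = 0 ∧ s = 0
  | a :: x, T, s => ∃ d T' s', d ≤ B ∧ T = d + X * T' ∧ s = d * a + s' ∧ PackedDot p X B x T' s'

theorem PackedDot.add_mul {B B' : ℕ} (c : ℕ) {x : List (ZMod p)} {T T' : ℕ} {s s' : ZMod p}
    (h : PackedDot p X B x T s) (h' : PackedDot p X B' x T' s') :
    PackedDot p X (B + c * B') x (T + c * T') (s + c * s') := by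
  induction x generalizing T T' s s' with
  | nil => obtain ⟨rfl, rfl⟩ := h; obtain ⟨rfl, rfl⟩ := h'; simp [PackedDot]
  | cons a x ih =>
    obtain ⟨d, T₁, s₁, hd, rfl, rfl, h₁⟩ := h
    obtain ⟨e, T₂, s₂, he, rfl, rfl, h₂⟩ := h'
    refine ⟨d + c * e, _, _, by gcongr, ?_, ?_, ih h₁ h₂⟩
    · ring
    · push_cast; ring

theorem PackedDot.scaleRow [NeZero p] {B : ℕ} (hB : B < X) (c : ℕ) {x : List (ZMod p)} {T : ℕ}
    {s : ZMod p} (h : PackedDot p X B x T s) :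
    PackedDot p X (p - 1) x (scaleRow p X c x.length T) (c * s) := by
  induction x generalizing T s with
  | nil => obtain ⟨rfl, rfl⟩ := h; simp [PackedDot, CF.scaleRow]
  | cons a x ih =>
    obtain ⟨d, T₁, s₁, hd, rfl, rfl, h₁⟩ := h
    have hdX : d < X := by omega
    refine ⟨d * c % p, _, _, Nat.le_sub_one_of_lt (Nat.mod_lt _ (NeZero.pos p)), ?_, ?_, ih h₁⟩
    · rw [List.length_cons, scaleRow_succ, Nat.add_mul_mod_self_left, Nat.mod_eq_of_lt hdX,
        Nat.add_mul_div_left _ _ (by omega), Nat.div_eq_of_lt hdX, zero_add]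
    · rw [ZMod.natCast_mod]; push_cast; ring

theorem PackedDot.zero (B : ℕ) (x : List (ZMod p)) : PackedDot p X B x 0 0 := by
  induction x with
  | nil => exact ⟨rfl, rfl⟩
  | cons a x ih => exact ⟨0, 0, 0, by simp, by simp, by simp, ih⟩

theorem PackedDot.mono {B B' : ℕ} (hB : B ≤ B') {x : List (ZMod p)} {T : ℕ} {s : ZMod p}
    (h : PackedDot p X B x T s) : PackedDot p X B' x T s := by
  simpa [Nat.add_sub_cancel' hB] using h.add_mul 1 (zero (B' - B) x)

theorem PackedDot.uncons {B : ℕ} (hB : B < X) {a : ZMod p} {x : List (ZMod p)} {T : ℕ} {s : ZMod p}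
    (h : PackedDot p X B (a :: x) T s) :
    T % X ≤ B ∧ PackedDot p X B x (T / X) (s - (T % X : ℕ) * a) := by
  obtain ⟨d, T', s', hd, rfl, rfl, h'⟩ := h
  have hdX : d < X := by omega
  rw [Nat.add_mul_mod_self_left, Nat.mod_eq_of_lt hdX, Nat.add_mul_div_left _ _ (by omega),
    Nat.div_eq_of_lt hdX, zero_add, add_sub_cancel_left]
  exact ⟨hd, h'⟩

theorem PackedDot.eq_zero_of_forall {B : ℕ} {x : List (ZMod p)} (hx : ∀ a ∈ x, a = 0) {T : ℕ}
    {s : ZMod p} (h : PackedDot p X B x T s) : s = 0 := by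
  induction x generalizing T s with
  | nil => exact h.2
  | cons a x ih =>
    obtain ⟨d, T', s', -, -, rfl, h'⟩ := h
    rw [hx a (by simp), ih (fun b hb => hx b (by simp [hb])) h', mul_zero, add_zero]

theorem eq_zero_of_elim [Fact p.Prime] {B : ℕ} {x : List (ZMod p)} {rows : List ℕ}
    (hB : B + x.length * p ^ 2 < X) (hrows : ∀ r ∈ rows, PackedDot p X B x r 0)
    (h : elim p X x.length rows = true) : ∀ a ∈ x, a = 0 := by
  induction x generalizing B rows with
  | nil => simp
  | cons a x ih =>
    have hp := (Fact.out : p.Prime).two_le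
    have hpp : p * (p - 1) + p = p ^ 2 := by
      obtain ⟨q, rfl⟩ := Nat.exists_eq_add_of_le' (one_le_two.trans hp)
      simp only [Nat.add_sub_cancel]; ring
    have hB' : B + p * (p - 1) + x.length * p ^ 2 + p < X := by
      rw [List.length_cons, add_one_mul] at hB; omega
    have hBX : B + p * (p - 1) + p < X := by
      have := Nat.zero_le (x.length * p ^ 2); omega
    rw [List.length_cons] at h
    cases rows with
    | nil => exact absurd h (by simp [elim])
    | cons r rs =>
      obtain ⟨c, hu, hel⟩ := elim_succ_cons h
      have hU : PackedDot p X (p - 1) (a :: x) (CF.scaleRow p X c (x.length + 1) r) 0 := by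
        simpa using (hrows r (by simp)).scaleRow (by omega) c
      generalize CF.scaleRow p X c (x.length + 1) r = u at hu hel hU
      have hx : ∀ b ∈ x, b = 0 := by
        refine ih (B := B + p * (p - 1)) (by omega) (fun t' ht' => ?_) hel
        obtain ⟨t, ht, rfl⟩ := List.mem_map.1 ht'
        have ht := hrows t (by simp [ht])
        have htB := (ht.uncons (by omega)).1
        have hadd := (ht.add_mul (p - t % X % p) hU).mono
          (Nat.add_le_add_left (Nat.mul_le_mul_right _ (Nat.sub_le _ _)) B)
        rw [mul_zero, add_zero] at hadd
        have hm : t % X % p < p := Nat.mod_lt _ (by omega)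
        have hd : (t + (p - t % X % p) * u) % X = t % X + (p - t % X % p) := by
          rw [Nat.add_mod, Nat.mul_mod, hu, mul_one, Nat.mod_mod, ← Nat.add_mod]
          conv_lhs => rw [Nat.add_mod]
          rw [← Nat.add_mod_mod, Nat.mod_mod, Nat.add_mod_mod, Nat.mod_eq_of_lt]
          omega
        have hs := (hadd.uncons (by omega)).2
        simpa [hd, Nat.cast_sub hm.le] using hs
      have ha : a = 0 := by
        have := (hU.uncons (by omega)).2.eq_zero_of_forall hx
        simpa [hu] using this
      simpa [ha] using hx

theorem PackedDot.pack {α : Type} {B : ℕ} (g : α → ℕ) (f : α → ZMod p) (l : List α)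
    (hg : ∀ a ∈ l, g a ≤ B) :
    PackedDot p X B (l.map f) (pack X g l) (l.map fun a => (g a : ZMod p) * f a).sum := by
  induction l with
  | nil => exact ⟨rfl, rfl⟩
  | cons a l ih =>
    exact ⟨g a, _, _, hg a (by simp), rfl, by simp, ih fun b hb => hg b (by simp [hb])⟩

theorem det_ne_zero_of_elim [Fact p.Prime] {α : Type} {B : ℕ} (l : List α) (g : α → ℕ → ℕ)
    (hB : B + l.length * p ^ 2 < X) (hg : ∀ a ∈ l, ∀ c < l.length, g a c ≤ B)
    (h : elim p X l.length (l.map fun a => CF.pack X (g a) (List.range l.length)) = true) :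
    (Matrix.of fun i c : Fin l.length => (g (l.get i) c : ZMod p)).det ≠ 0 := by
  intro hdet
  obtain ⟨v, hv0, hv⟩ := Matrix.exists_mulVec_eq_zero_iff.2 hdet
  refine hv0 (funext fun i => ?_)
  have hlen : ((List.finRange l.length).map v).length = l.length := by simp
  refine eq_zero_of_elim (x := (List.finRange l.length).map v)
    (rows := l.map fun a => CF.pack X (g a) (List.range l.length)) (B := B)
    (by rwa [hlen]) (fun r hr => ?_) (by rwa [hlen]) _ (List.mem_map_of_mem (List.mem_finRange i))
  obtain ⟨a, ha, rfl⟩ := List.mem_map.1 hr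
  obtain ⟨k, rfl⟩ := List.get_of_mem ha
  have := PackedDot.pack (X := X) (B := B) (fun c : Fin l.length => g (l.get k) c) v
    (List.finRange l.length) fun c _ => hg _ ha c c.2
  have hs := congrFun hv k
  simp only [Matrix.mulVec, dotProduct, Matrix.of_apply, Pi.zero_apply] at hs
  rw [← List.sum_ofFn, List.ofFn_eq_map] at hs
  rw [hs] at this
  rwa [← List.map_coe_finRange_eq_range, pack_map]

end

/-! ### Quartics through eight points, over an arbitrary semiring

The argument `n` plays the role of `-1`, so that the same formulas can be evaluated over `ℕ` with
`n = p - 1` to obtain the values modulo `p`. -/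

section
variable {S : Type*} [Mul S] [Add S]

/-- The determinant of three vectors. -/
def bracket (n : S) (u v x : Fin 3 → S) : S :=
  u 0 * (v 1 * x 2 + n * (v 2 * x 1)) + u 1 * (v 2 * x 0 + n * (v 0 * x 2)) +
    u 2 * (v 0 * x 1 + n * (v 1 * x 0))

/-- The linear form defining the line through the points number `a` and `b`. -/
def line (n : S) (P : Fin 8 × Fin 3 → S) (a b : Fin 8) (x : Fin 3 → S) : S :=
  bracket n (fun j => P (a, j)) (fun j => P (b, j)) x

/-- The residue of `k + m` modulo `7`. -/
def rot (k : Fin 7) (m : ℕ) : Fin 8 :=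
  ⟨Nat.mod (Nat.add k.1 m) 7, (Nat.mod_lt _ (by decide)).trans (by decide)⟩

/-- A product of four lines which together contain the eight points. -/
def quart (n : S) (P : Fin 8 × Fin 3 → S) (k : Fin 7) (x : Fin 3 → S) : S :=
  line n P 7 (rot k 0) x * line n P (rot k 1) (rot k 6) x *
    (line n P (rot k 2) (rot k 5) x * line n P (rot k 3) (rot k 4) x)

/-- The derivative of `quart n P k` at `x` in the direction `v`. -/
def dquart (n : S) (P : Fin 8 × Fin 3 → S) (k : Fin 7) (x v : Fin 3 → S) : S :=
  (line n P 7 (rot k 0) v * line n P (rot k 1) (rot k 6) x +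
      line n P 7 (rot k 0) x * line n P (rot k 1) (rot k 6) v) *
    (line n P (rot k 2) (rot k 5) x * line n P (rot k 3) (rot k 4) x) +
  line n P 7 (rot k 0) x * line n P (rot k 1) (rot k 6) x *
    (line n P (rot k 2) (rot k 5) v * line n P (rot k 3) (rot k 4) x +
      line n P (rot k 2) (rot k 5) x * line n P (rot k 3) (rot k 4) v)

/-- The projection from the point `w`, scaled by `w 6`. -/
def proj (n : S) (w y : Fin 7 → S) (i : Fin 6) : S :=
  w 6 * y i.castSucc + n * (w i.castSucc * y 6)

/-- The parametrization of the projected surface. -/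
def surf (n : S) (P : Fin 8 × Fin 3 → S) (w : Fin 7 → S) (x : Fin 3 → S) : Fin 6 → S :=
  proj n w fun k => quart n P k x

/-- The derivative of the parametrization of the projected surface. -/
def dsurf (n : S) (P : Fin 8 × Fin 3 → S) (w : Fin 7 → S) (x v : Fin 3 → S) : Fin 6 → S :=
  proj n w fun k => dquart n P k x v

end

section
variable {S T : Type*} [CommSemiring S] [CommSemiring T]

/-- The monomial with list of factors `l`, evaluated at `a`. -/
def mon (a : Fin 6 → S) (l : List (Fin 6)) : S := (l.map a).prod

/-- The derivative at `a` in the direction `t` of the monomial with list of factors `l`. -/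
def dmon (a t : Fin 6 → S) : List (Fin 6) → S
  | [] => 0
  | j :: l => t j * mon a l + a j * dmon a t l

theorem map_mon (f : S →+* T) (a : Fin 6 → S) (l : List (Fin 6)) :
    f (mon a l) = mon (f ∘ a) l := by
  simp [mon, map_list_prod]

theorem map_dmon (f : S →+* T) (a t : Fin 6 → S) (l : List (Fin 6)) :
    f (dmon a t l) = dmon (f ∘ a) (f ∘ t) l := by
  induction l with
  | nil => simp [dmon]
  | cons j l ih => simp [dmon, ih, map_mon]

theorem map_quart (f : S →+* T) (n : S) (P : Fin 8 × Fin 3 → S) (k : Fin 7) (x : Fin 3 → S) :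
    f (quart n P k x) = quart (f n) (f ∘ P) k (f ∘ x) := by
  simp [quart, line, bracket]

theorem map_dquart (f : S →+* T) (n : S) (P : Fin 8 × Fin 3 → S) (k : Fin 7) (x v : Fin 3 → S) :
    f (dquart n P k x v) = dquart (f n) (f ∘ P) k (f ∘ x) (f ∘ v) := by
  simp [dquart, line, bracket]

theorem map_surf (f : S →+* T) (n : S) (P : Fin 8 × Fin 3 → S) (w : Fin 7 → S) (x : Fin 3 → S) :
    f ∘ surf n P w x = surf (f n) (f ∘ P) (f ∘ w) (f ∘ x) := by
  ext i; simp [surf, proj, map_quart]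

theorem map_dsurf (f : S →+* T) (n : S) (P : Fin 8 × Fin 3 → S) (w : Fin 7 → S)
    (x v : Fin 3 → S) :
    f ∘ dsurf n P w x v = dsurf (f n) (f ∘ P) (f ∘ w) (f ∘ x) (f ∘ v) := by
  ext i; simp [dsurf, proj, map_dquart]

end

/-! ### The determinants expressing that the eight points and the projection are general -/

/-- The decimal digits of `N` as a vector, lowest digit first. -/
def digitVec {m : ℕ} (N : ℕ) (j : Fin m) : ℕ := Nat.mod (Nat.div N (Nat.pow 10 j.1)) 10

/-- Sample points of the plane. -/
def sample (k : ℕ) (j : Fin 3) : ℕ := Nat.pow (digitVec 351 j) (Nat.succ k)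

/-- The lowest `n` base-`6` digits of `c`. -/
def sixits (n : ℕ) : ℕ → List (Fin 6) :=
  Nat.rec (fun _ => []) (fun _ ih c => ⟨Nat.mod c 6, Nat.mod_lt _ (by decide)⟩ :: ih (Nat.div c 6)) n

/-- Exponents of monomials in three variables of degree `16`: the code of `(a, b, 16 - a - b)` is
`100 a + b`. -/
def planeCodes : List ℕ :=
  [1600, 1501, 1500, 1402, 1401, 1400, 1303, 1302, 1301, 1300, 313, 214, 213, 115, 114, 113, 16,
   15, 14, 13, 300, 201, 200, 102, 101, 100, 3, 2, 1, 0, 1204, 1203, 1105, 1202, 1104, 1006, 1201,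
   1103, 1005, 907, 1200, 1102, 1101, 1100, 1004, 1003, 1002, 1001, 906, 905, 1000, 904, 903, 902,
   901, 900, 808, 807, 806, 805, 804, 803, 802, 801, 709, 708, 707, 706, 705, 610, 800, 704, 703,
   702, 701, 700, 609, 608, 607, 606]

/-- Monomials of degree `5` in six variables, encoded in base `6`. -/
def quinticCodes : List ℕ :=
  [0, 1, 2, 3, 4, 5, 7, 8, 9, 10, 11, 15, 14, 16, 17, 21, 22, 23, 28, 29, 35, 43, 44, 45, 46, 47,
   50, 51, 52, 53, 57, 58, 59, 64, 65, 71, 86, 87, 88, 89, 93, 94, 95, 100, 101, 107, 129, 130,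
   131, 136, 137, 143, 172, 173, 179, 215, 259, 260, 261, 262, 263, 266, 267, 268, 269, 273, 274,
   275, 280, 281, 287, 302, 303, 304, 305, 309, 310, 311, 316, 317, 323, 345, 346, 347, 352, 353,
   359, 388, 389, 395, 431, 518, 519, 520, 521, 525, 526, 527, 532, 533, 539, 561, 562, 563, 568,
   569, 575, 604, 605, 611, 647, 777, 778, 779, 784, 785, 791, 820, 821, 827, 863, 1036, 1037,
   1043, 1079, 1295, 1555, 1556, 1557, 1558, 1559, 1562, 1563, 1564, 1565, 1569, 1570, 1571, 1576,
   1577, 1583, 1598, 1599, 1600, 1601, 1605, 1606, 1607, 1612, 1613, 1619, 1641, 1642, 1643, 1648,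
   1649, 1655, 1684, 1685, 1691, 1727, 1814, 1815, 1816, 1817, 1821, 1822, 1823, 1828, 1829, 1835,
   1857, 1858, 1859, 1864, 1865, 1871, 1900, 1901, 1907, 1943, 2073, 2074, 2075, 2080, 2081, 2087,
   2116, 2117, 2123, 2159, 2332, 2333, 2339, 2375, 2591, 3110, 3111, 3112, 3113, 3117, 3118, 3119,
   3124, 3125, 3131, 3153, 3154, 3155, 3160, 3161, 3167, 3196, 3197, 3203, 3239, 3369, 3370, 3371,
   3376, 3377, 3383, 3412, 3413, 3419, 3455, 3628, 3629, 3635, 3671, 3887, 4665, 4666, 4667, 4672,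
   4673, 4679, 4708, 4709, 4715, 4751, 4924, 4925, 4931, 4967, 5183, 6220]

/-- Pairs of a monomial of degree `4` in six variables and an index, encoded in base `6`. -/
def quarticCodes : List ℕ :=
  [1, 2, 3, 4, 5, 7, 8, 9, 10, 11, 14, 15, 16, 17, 21, 22, 23, 28, 29, 35, 43, 44, 45, 46, 47, 50,
   51, 52, 53, 57, 58, 59, 64, 65, 86, 87, 88, 89, 93, 94, 95, 100, 259, 260, 261, 262, 263, 266,
   267, 268, 269, 273, 274, 275, 280, 281, 302, 303, 304, 305, 309, 310, 311, 316, 518, 519, 520,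
   521, 525, 526, 527, 532, 1298, 1299, 1300, 1301, 1304, 1305, 1306, 1307, 1310, 1311, 1312, 1313,
   1317, 1318, 1319, 1324, 1325, 1331, 1340, 1341, 1342, 1343, 1346, 1347, 1348, 1349, 1353, 1354,
   1355, 1360, 1361, 1382, 1383, 1384, 1385, 1389, 1390, 1391, 1396, 1556, 1557, 1558, 1559, 1562,
   1563, 1564, 1565, 1569, 1570, 1571, 1576, 1577, 1598, 1599, 1600, 1601, 1605, 1606, 1607, 1612,
   1814, 1815, 1816, 1817, 1821, 1822, 1823, 1828, 2595, 2596, 2597, 2601, 2602, 2603, 2607, 2608,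
   2609, 2613, 2614, 2615, 2620, 2621, 2627, 2637, 2638, 2639, 2643, 2644, 2645, 2649, 2650, 2651,
   2656, 2657, 2679, 2680, 2681, 2685, 2686, 2687, 2692, 2853, 2854, 2855, 2859, 2860, 2861, 2865,
   2866, 2867, 2872, 2873, 2895, 2896, 2897, 2901, 2902, 2903, 2908]

/-- The exponent vector with the given code. -/
def planeExp (c : ℕ) (j : Fin 3) : ℕ :=
  Nat.rec (Nat.div c 100) (fun i _ => Nat.rec (Nat.mod c 100)
    (fun _ _ => Nat.sub 16 (Nat.add (Nat.div c 100) (Nat.mod c 100))) i) j.1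

/-- Exponent vectors of degree `3`, as decimal digits. -/
def cubicExp (c : ℕ) (j : Fin 3) : ℕ :=
  digitVec (List.getD [3, 12, 102, 21, 111, 201, 30, 120, 210, 300] c 0) j

section
variable {R T : Type*} [CommRing R] [CommRing T]

/-- Values of the quartics at sample points. -/
def quartMat (P : Fin 8 × Fin 3 → R) : Matrix (Fin 7) (Fin 7) R :=
  Matrix.of fun k c => quart (-1) P k fun j => (sample c j : R)

/-- The coefficient of `y ^ d` in `(a + y) ^ e`. -/
def taylorCoeff (a : Fin 3 → R) (e d : Fin 3 → ℕ) : R :=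
  ∏ j, ((e j).choose (d j) : R) * a j ^ (e j - d j)

/-- Taylor coefficients of order `3` of plane monomials of degree `16` at the eight points. -/
def planeMat (P : Fin 8 × Fin 3 → R) :
    Matrix (Fin planeCodes.length) (Fin planeCodes.length) R :=
  Matrix.of fun i c => taylorCoeff (fun j => P (Fin.ofNat 8 (c.1 / 10), j))
    (planeExp (planeCodes.get i)) (cubicExp (c.1 % 10))

/-- Partial derivatives of quintic monomials at points of the projected surface. -/
def quinticMat (P : Fin 8 × Fin 3 → R) (w : Fin 7 → R) :
    Matrix (Fin quinticCodes.length) (Fin quinticCodes.length) R :=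
  Matrix.of fun i c => dmon (surf (-1) P w fun j => (sample (c.1 / 3) j : R))
    (fun j => (digitVec (10 ^ (c.1 % 6)) j : R)) (sixits 5 (quinticCodes.get i))

/-- Values on quartic monomials of the functionals which vanish on the gradients of quintics. -/
def quarticMat (P : Fin 8 × Fin 3 → R) (w : Fin 7 → R) :
    Matrix (Fin quarticCodes.length) (Fin quarticCodes.length) R :=
  Matrix.of fun i c =>
    let a := surf (-1) P w fun j => (sample (c.1 / 2) j : R)
    let t := dsurf (-1) P w (fun j => (sample (c.1 / 2) j : R))
      fun j => (digitVec (10 ^ (c.1 % 2)) j : R)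
    let k := Fin.ofNat 6 (quarticCodes.get i / 1296)
    let l := sixits 4 (quarticCodes.get i)
    4 * mon a l * t k - a k * dmon a t l

/-- The eight points and the centre of projection are general if this does not vanish. -/
def genericity (P : Fin 8 × Fin 3 → R) (w : Fin 7 → R) : R :=
  (quartMat P).det * (planeMat P).det * (quinticMat P w).det * (quarticMat P w).det * w 6

theorem map_genericity (f : R →+* T) (P : Fin 8 × Fin 3 → R) (w : Fin 7 → R) :
    f (genericity P w) = genericity (f ∘ P) (f ∘ w) := by
  have h1 : f.mapMatrix (quartMat P) = quartMat (f ∘ P) := by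
    ext k c
    simp [quartMat, map_quart, Function.comp_def]
  have h2 : f.mapMatrix (planeMat P) = planeMat (f ∘ P) := by
    ext k c
    simp [planeMat, taylorCoeff]
  have h3 : f.mapMatrix (quinticMat P w) = quinticMat (f ∘ P) (f ∘ w) := by
    ext k c
    simp [quinticMat, map_dmon, map_surf]
    simp [Function.comp_def]
  have h4 : f.mapMatrix (quarticMat P w) = quarticMat (f ∘ P) (f ∘ w) := by
    ext k c
    have hs (m : ℕ) : (f ∘ fun j => (sample m j : R)) = fun j => (sample m j : T) := by
      ext; simp
    have hd (m : ℕ) : (f ∘ fun j : Fin 3 => (digitVec m j : R)) = fun j => (digitVec m j : T) := by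
      ext; simp
    have hf (x i) : f (surf (-1) P w x i) = surf (f (-1)) (f ∘ P) (f ∘ w) (f ∘ x) i :=
      congrFun (map_surf f _ P w x) i
    have hf' (x v i) : f (dsurf (-1) P w x v i) =
        dsurf (f (-1)) (f ∘ P) (f ∘ w) (f ∘ x) (f ∘ v) i := congrFun (map_dsurf f _ P w x v) i
    simp only [quarticMat, RingHom.mapMatrix_apply, Matrix.map_apply, Matrix.of_apply, map_sub,
      map_mul, map_ofNat, map_mon, map_dmon, map_surf, map_dsurf, hf, hf', map_neg, map_one, hs, hd]
  simp [genericity, RingHom.map_det, h1, h2, h3, h4]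

end
/-! ### An example over the field with `1009` elements -/

/-- Eight plane points with small integral coordinates. -/
def pts (v : Fin 8 × Fin 3) : ℕ :=
  Nat.mod (Nat.div 941251731321111100010001 (Nat.pow 10 (Nat.add (Nat.mul 3 v.1.1) v.2.1))) 10

/-- A centre of projection with small integral coordinates. -/
def ctr (k : Fin 7) : ℕ := digitVec 1475321 k

/-- A number larger than all the intermediate results, used as the base for packing. -/
def limb : ℕ := 100000000000000000039

section
variable {p X Y : ℕ}

theorem mod_pack {α : Type} {f : α → ℕ} (l : List α) (hf : ∀ a ∈ l, f a < Y)
    {i : ℕ} (hi : i < l.length) : pack Y f l / Y ^ i % Y = f l[i] := by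
  induction l generalizing i with
  | nil => simp at hi
  | cons a l ih =>
    have ha := hf a (by simp)
    have hY : 0 < Y := by omega
    rw [pack_cons]
    cases i with
    | zero => simp [Nat.add_mul_mod_self_left, Nat.mod_eq_of_lt ha]
    | succ i =>
      rw [pow_succ', ← Nat.div_div_eq_div_mul, Nat.add_mul_div_left _ _ hY, Nat.div_eq_of_lt ha,
        zero_add, ih (fun b hb => hf b (by simp [hb])) (by simpa using hi)]
      simp

/-- The six values of `a + X * t` modulo `p`, packed in base `Y`. -/
def dualPack (p X Y : ℕ) (a t : Fin 6 → ℕ) : ℕ :=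
  pack Y (fun j => Nat.add (Nat.mod (a j) p) (Nat.mul X (Nat.mod (t j) p)))
    [⟨0, by decide⟩, ⟨1, by decide⟩, ⟨2, by decide⟩, ⟨3, by decide⟩, ⟨4, by decide⟩, ⟨5, by decide⟩]

theorem mod_dualPack [NeZero p] (hX : p < X) (a t : Fin 6 → ℕ) (i : Fin 6) :
    dualPack p X (X * X) a t / (X * X) ^ i.1 % (X * X) = a i % p + X * (t i % p) := by
  have hp := NeZero.pos p
  have key (j : Fin 6) : a j % p + X * (t j % p) < X * X := by
    have h1 := Nat.mod_lt (a j) hp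
    have h2 := Nat.mod_lt (t j) hp
    nlinarith
  refine (mod_pack (f := fun j => a j % p + X * (t j % p)) _ (fun j _ => key j) i.2).trans ?_
  fin_cases i <;> rfl

/-- The product of the dual numbers at the positions given by the powers of `Y` in `l`. -/
def dualProd (Y v : ℕ) (l : List ℕ) : ℕ :=
  List.rec 1 (fun y _ ih => Nat.mul (Nat.mod (Nat.div v y) Y) ih) l

theorem dualProd_eq (f : Fin 6 → ℕ) (v : ℕ) (hv : ∀ i : Fin 6, v / Y ^ i.1 % Y = f i)
    (l : List (Fin 6)) : dualProd Y v (l.map fun i => Nat.pow Y i.1) = (l.map f).prod := by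
  induction l with
  | nil => rfl
  | cons i l ih =>
    rw [List.map_cons, List.map_cons, List.prod_cons, ← ih, ← hv i]
    rfl

theorem prod_dual (X : ℕ) (a t : Fin 6 → ℕ) (l : List (Fin 6)) :
    ∃ r, (l.map fun i => a i + X * t i).prod = mon a l + X * (dmon a t l + X * r) := by
  induction l with
  | nil => exact ⟨0, by simp [mon, dmon]⟩
  | cons i l ih =>
    obtain ⟨r, hr⟩ := ih
    refine ⟨t i * dmon a t l + r * a i + X * (t i * r), ?_⟩
    rw [List.map_cons, List.prod_cons, hr]
    simp only [mon, dmon, List.map_cons, List.prod_cons]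
    ring

theorem mon_lt [NeZero p] (a : Fin 6 → ℕ) (ha : ∀ i, a i < p) (l : List (Fin 6)) :
    mon a l ≤ p ^ l.length := by
  induction l with
  | nil => simp [mon]
  | cons i l ih =>
    rw [mon, List.map_cons, List.prod_cons, List.length_cons, pow_succ']
    exact Nat.mul_le_mul (ha i).le ih

theorem dmon_lt [NeZero p] (a t : Fin 6 → ℕ) (ha : ∀ i, a i < p) (ht : ∀ i, t i < p)
    (l : List (Fin 6)) : dmon a t l ≤ l.length * p ^ l.length := by
  induction l with
  | nil => simp [dmon]
  | cons i l ih =>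
    rw [dmon, List.length_cons, pow_succ']
    calc _ ≤ p * p ^ l.length + p * (l.length * p ^ l.length) :=
        add_le_add (Nat.mul_le_mul (ht i).le (mon_lt a ha l)) (Nat.mul_le_mul (ha i).le ih)
      _ = _ := by ring

theorem dualProd_dualPack [NeZero p] (hp : 1 < p) (a t : Fin 6 → ℕ) (l : List (Fin 6))
    (hX : (l.length + 1) * p ^ (l.length + 1) < X) :
    let q := dualProd (X * X) (dualPack p X (X * X) a t) (l.map fun i => Nat.pow (X * X) i.1)
    q % X = mon (fun i => a i % p) l ∧
      q / X % X = dmon (fun i => a i % p) (fun i => t i % p) l := by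
  have hpX : p < X := by
    refine lt_of_le_of_lt ?_ hX
    calc p = 1 * p ^ 1 := by simp
      _ ≤ _ := Nat.mul_le_mul (by omega) (Nat.pow_le_pow_right (by omega) (by omega))
  intro q
  obtain ⟨r, hr⟩ := prod_dual X (fun i => a i % p) (fun i => t i % p) l
  have hq : q = mon (fun i => a i % p) l +
      X * (dmon (fun i => a i % p) (fun i => t i % p) l + X * r) := by
    rw [← hr]
    exact dualProd_eq _ _ (mod_dualPack hpX a t) l
  have hpow : p ^ l.length ≤ p ^ (l.length + 1) := Nat.pow_le_pow_right (by omega) (by omega)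
  have hm := mon_lt (p := p) (fun i => a i % p) (fun i => Nat.mod_lt _ (by omega)) l
  have hd := dmon_lt (p := p) (fun i => a i % p) (fun i => t i % p)
    (fun i => Nat.mod_lt _ (by omega)) (fun i => Nat.mod_lt _ (by omega)) l
  have hmX : mon (fun i => a i % p) l < X := by nlinarith
  have hdX : dmon (fun i => a i % p) (fun i => t i % p) l < X := by nlinarith
  constructor
  · rw [hq, Nat.add_mul_mod_self_left, Nat.mod_eq_of_lt hmX]
  · rw [hq, Nat.add_mul_div_left _ _ (by omega), Nat.div_eq_of_lt hmX, zero_add,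
      Nat.add_mul_mod_self_left, Nat.mod_eq_of_lt hdX]

theorem length_sixits (n c : ℕ) : (sixits n c).length = n := by
  induction n generalizing c with
  | zero => rfl
  | succ n ih => exact congrArg Nat.succ (ih (c / 6))

theorem cast_mon_mod (a : Fin 6 → ℕ) (l : List (Fin 6)) :
    ((mon (fun i => a i % p) l : ℕ) : ZMod p) = mon (fun i => (a i : ZMod p)) l := by
  have := map_mon (Nat.castRingHom (ZMod p)) (fun i => a i % p) l
  simpa [Function.comp_def] using this

theorem cast_dmon_mod (a t : Fin 6 → ℕ) (l : List (Fin 6)) :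
    ((dmon (fun i => a i % p) (fun i => t i % p) l : ℕ) : ZMod p) =
      dmon (fun i => (a i : ZMod p)) (fun i => (t i : ZMod p)) l := by
  have := map_dmon (Nat.castRingHom (ZMod p)) (fun i => a i % p) (fun i => t i % p) l
  simpa [Function.comp_def] using this

end

/-- Elimination modulo `p` for the matrix with columns described by `V` and rows described by the
indices `idx a`, for `a` in `codes`. -/
def elimCols (p X n : ℕ) (V : ℕ → ℕ → ℕ → ℕ) (idx : ℕ → List (Fin 6))
    (g : ℕ → ℕ → List ℕ → ℕ → ℕ) (codes : List ℕ) : Bool :=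
  force X fun X => force (Nat.mul X X) fun Y => forceMap (V X Y) (List.range n) fun cols =>
    forceMap (fun a => forceMap (fun i => Nat.pow Y i.1) (idx a) fun l => pack X (g X Y l) cols)
      codes (elim p X n)

theorem elimCols_eq (p X n : ℕ) (V : ℕ → ℕ → ℕ → ℕ) (idx : ℕ → List (Fin 6))
    (g : ℕ → ℕ → List ℕ → ℕ → ℕ) (codes : List ℕ) :
    elimCols p X n V idx g codes = elim p X n (codes.map fun a => pack X
      (fun c => g X (X * X) ((idx a).map fun i => Nat.pow (X * X) i.1) (V X (X * X) c))
      (List.range n)) := by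
  simp only [elimCols, force_eq, forceMap_eq, pack_map]
  rfl

/-- The coordinate vectors. -/
def unitVec (n : ℕ) (j : Fin 6) : ℕ := digitVec (Nat.pow 10 (Nat.mod n 6)) j

/-- A point of the projected surface together with a coordinate vector. -/
def quinticCol (X Y c : ℕ) : ℕ :=
  dualPack 1009 X Y (surf 1008 pts ctr (sample (Nat.div c 3))) (unitVec c)

/-- A point of the projected surface together with a tangent vector. -/
def quarticCol (X Y c : ℕ) : ℕ :=
  dualPack 1009 X Y (surf 1008 pts ctr (sample (Nat.div c 2)))
    (dsurf 1008 pts ctr (sample (Nat.div c 2)) (digitVec (Nat.pow 10 (Nat.mod c 2))))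

/-- The derivative part of a product of dual numbers. -/
def quinticEntry (X Y : ℕ) (l : List ℕ) (v : ℕ) : ℕ := Nat.mod (Nat.div (dualProd Y v l) X) X

/-- The combination of values and derivatives which occurs in `quarticMat`. -/
def quarticEntry (X Y : ℕ) (l : List ℕ) (v : ℕ) : ℕ :=
  List.rec 0 (fun y l _ => force (dualProd Y v l) fun q => force (Nat.mod (Nat.div v y) Y) fun e =>
    Nat.add (Nat.mul (Nat.mul 4 (Nat.mod q X)) (Nat.div e X))
      (Nat.mul (Nat.mul 1008 (Nat.mod e X)) (Nat.mod (Nat.div q X) X))) l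

/-- The indices describing a row of `quarticMat`. -/
def quarticIdx (c : ℕ) : List (Fin 6) :=
  ⟨Nat.mod (Nat.div c 1296) 6, Nat.mod_lt _ (by decide)⟩ :: sixits 4 c

/-- An arithmetic form of the binomial coefficient. -/
def binom (e d : ℕ) : ℕ :=
  Nat.div (Nat.rec 1 (fun k ih => Nat.mul (Nat.sub e k) ih) d)
    (Nat.rec 1 (fun k ih => Nat.mul (Nat.succ k) ih) d)

/-- The entries of `planeMat`. -/
def planeEntry (a c : ℕ) : ℕ :=
  Nat.mod (Nat.mul (Nat.mul (f 0) (f 1)) (f 2)) 1009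
where
  f (j : Fin 3) : ℕ := Nat.mul (binom (planeExp a j) (cubicExp (Nat.mod c 10) j))
    (Nat.pow (pts (⟨Nat.mod (Nat.div c 10) 8, Nat.mod_lt _ (by decide)⟩, j))
      (Nat.sub (planeExp a j) (cubicExp (Nat.mod c 10) j)))

/-- The entries of `quartMat`. -/
def quartEntry (k c : ℕ) : ℕ :=
  Nat.mod (quart 1008 pts ⟨Nat.mod k 7, Nat.mod_lt _ (by decide)⟩ (sample c)) 1009

/-- Elimination modulo `1009` for a matrix given by its entries. -/
def elimEntries (X n : ℕ) (g : ℕ → ℕ → ℕ) (codes : List ℕ) : Bool :=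
  force X fun X => forceMap (fun a => pack X (g a) (List.range n)) codes (elim 1009 X n)

theorem elim_quart : elimEntries limb 7 quartEntry [0, 1, 2, 3, 4, 5, 6] = true := by
  decide +kernel

theorem elim_plane : elimEntries limb 80 planeEntry planeCodes = true := by
  decide +kernel

theorem elim_quintic :
    elimCols 1009 limb 247 quinticCol (sixits 5) quinticEntry quinticCodes = true := by
  decide +kernel

theorem elim_quartic :
    elimCols 1009 limb 191 quarticCol quarticIdx quarticEntry quarticCodes = true := by
  decide +kernel

instance : Fact (Nat.Prime 1009) := ⟨by norm_num⟩

theorem neg_one_eq : ((1008 : ℕ) : ZMod 1009) = -1 := by decide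

theorem cast_surf (x : Fin 3 → ℕ) (i : Fin 6) :
    ((surf 1008 pts ctr x i : ℕ) : ZMod 1009) =
      surf (-1) (fun v => (pts v : ZMod 1009)) (fun k => (ctr k : ZMod 1009))
        (fun j => (x j : ZMod 1009)) i := by
  rw [← neg_one_eq]
  exact congrFun (map_surf (Nat.castRingHom (ZMod 1009)) 1008 pts ctr x) i

theorem cast_dsurf (x v : Fin 3 → ℕ) (i : Fin 6) :
    ((dsurf 1008 pts ctr x v i : ℕ) : ZMod 1009) =
      dsurf (-1) (fun v => (pts v : ZMod 1009)) (fun k => (ctr k : ZMod 1009))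
        (fun j => (x j : ZMod 1009)) (fun j => (v j : ZMod 1009)) i := by
  rw [← neg_one_eq]
  exact congrFun (map_dsurf (Nat.castRingHom (ZMod 1009)) 1008 pts ctr x v) i

theorem det_quartMat_ne_zero :
    (quartMat fun v => (pts v : ZMod 1009)).det ≠ 0 := by
  have h := det_ne_zero_of_elim (p := 1009) (X := limb) (B := 1008) [0, 1, 2, 3, 4, 5, 6] quartEntry
    (by norm_num [limb])
    (fun a _ c _ => Nat.le_of_lt_succ (Nat.mod_lt _ (by norm_num))) (by
      have := elim_quart
      rwa [elimEntries, force_eq, forceMap_eq] at this)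
  suffices hM : (quartMat fun v => (pts v : ZMod 1009)) = Matrix.of fun k c : Fin 7 =>
      ((quartEntry ([0, 1, 2, 3, 4, 5, 6].get k) c : ℕ) : ZMod 1009) by rw [hM]; exact h
  ext k c
  have hk : [0, 1, 2, 3, 4, 5, 6].get k = k.1 := by fin_cases k <;> rfl
  rw [Matrix.of_apply, hk]
  have : (⟨Nat.mod k.1 7, Nat.mod_lt _ (by decide)⟩ : Fin 7) = k := Fin.ext (Nat.mod_eq_of_lt k.2)
  rw [quartEntry, this]
  erw [ZMod.natCast_mod]
  rw [quartMat, Matrix.of_apply, ← neg_one_eq]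
  exact (map_quart (Nat.castRingHom (ZMod 1009)) 1008 pts k (sample c)).symm

theorem binom_eq (e d : ℕ) : binom e d = e.choose d := by
  have h1 : (Nat.rec 1 (fun k ih => Nat.mul (Nat.sub e k) ih) d : ℕ) = e.descFactorial d := by
    induction d with
    | zero => rfl
    | succ d ih => rw [Nat.descFactorial_succ, ← ih]; rfl
  have h2 : (Nat.rec 1 (fun k ih => Nat.mul (Nat.succ k) ih) d : ℕ) = d.factorial := by
    clear h1
    induction d with
    | zero => rfl
    | succ d ih => rw [Nat.factorial_succ, ← ih]; rfl
  rw [Nat.choose_eq_descFactorial_div_factorial, ← h1, ← h2]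
  rfl

theorem det_planeMat_ne_zero :
    (planeMat fun v => (pts v : ZMod 1009)).det ≠ 0 := by
  have h := det_ne_zero_of_elim (p := 1009) (X := limb) (B := 1008) planeCodes planeEntry
    (by decide +kernel)
    (fun a _ c _ => Nat.le_of_lt_succ (Nat.mod_lt _ (by norm_num))) (by
      have := elim_plane
      rwa [elimEntries, force_eq, forceMap_eq] at this)
  convert h using 2
  ext k c
  rw [Matrix.of_apply, planeEntry]
  erw [ZMod.natCast_mod]
  rw [planeMat, Matrix.of_apply, taylorCoeff, Fin.prod_univ_three]
  have key (j : Fin 3) : ((planeEntry.f (planeCodes.get k) c.1 j : ℕ) : ZMod 1009) =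
      ((planeExp (planeCodes.get k) j).choose (cubicExp (c.1 % 10) j) : ZMod 1009) *
        (pts (Fin.ofNat 8 (c.1 / 10), j) : ZMod 1009) ^
          (planeExp (planeCodes.get k) j - cubicExp (c.1 % 10) j) := by
    rw [← binom_eq, ← Nat.cast_pow, ← Nat.cast_mul]
    rfl
  rw [← key, ← key, ← key, ← Nat.cast_mul, ← Nat.cast_mul]
  rfl

theorem det_quinticMat_ne_zero :
    (quinticMat (fun v => (pts v : ZMod 1009)) fun k => (ctr k : ZMod 1009)).det ≠ 0 := by
  have hX : (5 + 1) * 1009 ^ (5 + 1) < limb := by norm_num [limb]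
  have hE (a c : ℕ) : quinticEntry limb (limb * limb)
      ((sixits 5 a).map fun i => Nat.pow (limb * limb) i.1) (quinticCol limb (limb * limb) c) =
      dmon (fun i => surf 1008 pts ctr (sample (Nat.div c 3)) i % 1009)
        (fun i => unitVec c i % 1009) (sixits 5 a) := (dualProd_dualPack (p := 1009) (X := limb) (by norm_num)
    (surf 1008 pts ctr (sample (Nat.div c 3))) (unitVec c) (sixits 5 a)
    (by rw [length_sixits]; exact hX)).2
  have h := det_ne_zero_of_elim (p := 1009) (X := limb) (B := 5 * 1009 ^ 5) quinticCodes _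
    (by decide +kernel) (fun a _ c _ => ?_)
    (by
      rw [show quinticCodes.length = 247 by decide +kernel]
      exact (elimCols_eq _ _ _ _ _ _ _).symm.trans elim_quintic)
  · convert h using 2
    ext k c
    rw [Matrix.of_apply]
    rw [hE]
    rw [cast_dmon_mod, quinticMat, Matrix.of_apply]
    simp only [cast_surf]
    rfl
  · rw [hE]
    refine (dmon_lt (p := 1009) _ _ (fun i => Nat.mod_lt _ (by norm_num))
      (fun i => Nat.mod_lt _ (by norm_num)) _).trans ?_
    rw [length_sixits]

theorem det_quarticMat_ne_zero :
    (quarticMat (fun v => (pts v : ZMod 1009)) fun k => (ctr k : ZMod 1009)).det ≠ 0 := by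
  have hX : (4 + 1) * 1009 ^ (4 + 1) < limb := by norm_num [limb]
  have hq (a c : ℕ) := dualProd_dualPack (p := 1009) (X := limb) (by norm_num)
    (surf 1008 pts ctr (sample (Nat.div c 2)))
    (dsurf 1008 pts ctr (sample (Nat.div c 2)) (digitVec (Nat.pow 10 (Nat.mod c 2))))
    (sixits 4 a) (by rw [length_sixits]; exact hX)
  have he (c : ℕ) (i : Fin 6) := mod_dualPack (p := 1009) (X := limb) (by norm_num [limb])
    (surf 1008 pts ctr (sample (Nat.div c 2)))
    (dsurf 1008 pts ctr (sample (Nat.div c 2)) (digitVec (Nat.pow 10 (Nat.mod c 2)))) i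
  have hE (a c : ℕ) : quarticEntry limb (limb * limb)
      ((quarticIdx a).map fun i => Nat.pow (limb * limb) i.1) (quarticCol limb (limb * limb) c) =
      4 * mon (fun i => surf 1008 pts ctr (sample (Nat.div c 2)) i % 1009) (sixits 4 a) *
        (dsurf 1008 pts ctr (sample (Nat.div c 2)) (digitVec (Nat.pow 10 (Nat.mod c 2)))
          (Fin.ofNat 6 (a / 1296)) % 1009) +
      1008 * (surf 1008 pts ctr (sample (Nat.div c 2)) (Fin.ofNat 6 (a / 1296)) % 1009) *
        dmon (fun i => surf 1008 pts ctr (sample (Nat.div c 2)) i % 1009)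
          (fun i => dsurf 1008 pts ctr (sample (Nat.div c 2)) (digitVec (Nat.pow 10 (Nat.mod c 2))) i
            % 1009) (sixits 4 a) := by
    rw [← (hq a c).1, ← (hq a c).2]
    have h1 := he c (Fin.ofNat 6 (a / 1296))
    have h2 := Nat.mod_lt (dsurf 1008 pts ctr (sample (Nat.div c 2))
      (digitVec (Nat.pow 10 (Nat.mod c 2))) (Fin.ofNat 6 (a / 1296))) (show 1009 > 0 by norm_num)
    have h3 := Nat.mod_lt (surf 1008 pts ctr (sample (Nat.div c 2)) (Fin.ofNat 6 (a / 1296)))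
      (show 1009 > 0 by norm_num)
    have h4 : 1009 < limb := by norm_num [limb]
    generalize dsurf 1008 pts ctr (sample (Nat.div c 2))
      (digitVec (Nat.pow 10 (Nat.mod c 2))) (Fin.ofNat 6 (a / 1296)) % 1009 = t at h1 h2 ⊢
    generalize surf 1008 pts ctr (sample (Nat.div c 2)) (Fin.ofNat 6 (a / 1296)) % 1009 = s
      at h1 h3 ⊢
    have h5 : t = (s + limb * t) / limb := by
      rw [Nat.add_mul_div_left _ _ (by omega), Nat.div_eq_of_lt (by omega), zero_add]
    have h6 : s = (s + limb * t) % limb := by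
      rw [Nat.add_mul_mod_self_left, Nat.mod_eq_of_lt (by omega)]
    conv_rhs => rw [h5]
    conv_rhs =>
      arg 2
      rw [h6]
    rw [← h1]
    rfl
  have h := det_ne_zero_of_elim (p := 1009) (X := limb)
    (B := 4 * 1009 ^ 4 * 1009 + 1008 * 1009 * (4 * 1009 ^ 4)) quarticCodes _
    (by decide +kernel) (fun a _ c _ => ?_)
    ((elimCols_eq _ _ _ _ _ _ _).symm.trans elim_quartic)
  · convert h using 2
    ext k c
    rw [Matrix.of_apply]
    rw [hE]
    rw [Nat.cast_add, Nat.cast_mul, Nat.cast_mul, Nat.cast_mul, Nat.cast_mul, cast_dmon_mod,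
      cast_mon_mod, quarticMat, Matrix.of_apply, neg_one_eq, ZMod.natCast_mod, ZMod.natCast_mod]
    simp only [cast_surf, cast_dsurf]
    rw [neg_one_mul, neg_mul, ← sub_eq_add_neg]
    rfl
  · rw [hE]
    have hm := mon_lt (p := 1009)
      (fun i => surf 1008 pts ctr (sample (Nat.div c 2)) i % 1009)
      (fun i => Nat.mod_lt _ (by norm_num)) (sixits 4 a)
    have hd := dmon_lt (p := 1009) (fun i => surf 1008 pts ctr (sample (Nat.div c 2)) i % 1009)
      (fun i => dsurf 1008 pts ctr (sample (Nat.div c 2)) (digitVec (Nat.pow 10 (Nat.mod c 2))) i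
        % 1009)
      (fun i => Nat.mod_lt _ (by norm_num)) (fun i => Nat.mod_lt _ (by norm_num)) (sixits 4 a)
    rw [length_sixits] at hm hd
    gcongr
    · exact (Nat.mod_lt _ (by norm_num)).le
    · exact (Nat.mod_lt _ (by norm_num)).le

theorem genericity_pts_ne_zero :
    genericity (fun v => (pts v : ZMod 1009)) (fun k => (ctr k : ZMod 1009)) ≠ 0 := by
  refine mul_ne_zero (mul_ne_zero (mul_ne_zero (mul_ne_zero det_quartMat_ne_zero
    det_planeMat_ne_zero) det_quinticMat_ne_zero) det_quarticMat_ne_zero) ?_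
  decide

theorem genericity_complex_ne_zero :
    genericity (fun v => (pts v : ℂ)) (fun k => (ctr k : ℂ)) ≠ 0 := by
  have hZ : genericity (fun v => (pts v : ℤ)) (fun k => (ctr k : ℤ)) ≠ 0 := by
    intro h
    apply genericity_pts_ne_zero
    have := map_genericity (Int.castRingHom (ZMod 1009)) (fun v => (pts v : ℤ))
      (fun k => (ctr k : ℤ))
    rw [h, map_zero] at this
    simpa [Function.comp_def] using this.symm
  have := map_genericity (Int.castRingHom ℂ) (fun v => (pts v : ℤ)) (fun k => (ctr k : ℤ))
  intro h
  refine hZ (Int.cast_injective (α := ℂ) ?_)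
  simpa [Function.comp_def, h] using this
/-! ### Dimensions of spaces of forms -/

theorem finrank_forms (n d : ℕ) :
    Module.finrank ℂ (homogeneousSubmodule (Fin n) ℂ d) = (n + d - 1).choose d := by
  have hs : {e : Fin n →₀ ℕ | e.degree = d} =
      ((Finset.univ : Finset (Fin n)).finsuppAntidiag d : Set (Fin n →₀ ℕ)) := by
    ext e
    simp [Finset.mem_finsuppAntidiag, Finsupp.degree_eq_sum]
  rw [homogeneousSubmodule_eq_finsupp_supported, hs,
    (AddMonoidAlgebra.supportedEquivFinsupp _).finrank_eq, Module.finrank_finsupp_self]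
  simp [Finset.card_finsuppAntidiag_nat_eq_choose]

instance (n d : ℕ) : Module.Finite ℂ (homogeneousSubmodule (Fin n) ℂ d) :=
  Module.Finite.iff_fg.2 (homogeneousSubmodule_fg (Fin n) ℂ d)

theorem finrank_ker_add {K V : Type*} [Field K] [AddCommGroup V] [Module K V]
    [FiniteDimensional K V] {n : ℕ} (Φ : V →ₗ[K] (Fin n → K)) (e : Fin n → V)
    {M : Matrix (Fin n) (Fin n) K} (hM : M.det ≠ 0) (h : ∀ i c, Φ (e i) c = M i c) :
    Module.finrank K (LinearMap.ker Φ) + n = Module.finrank K V := by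
  have hs : LinearMap.range Φ = ⊤ := by
    have hli : LinearIndependent K fun i => Φ (e i) := by
      have he : (fun i => Φ (e i)) = M.row := by
        ext i c
        exact h i c
      rw [he]
      exact Matrix.linearIndependent_rows_of_det_ne_zero hM
    have := hli.span_eq_top_of_card_eq_finrank' (by simp)
    rw [eq_top_iff, ← this, Submodule.span_le]
    rintro _ ⟨i, rfl⟩
    exact ⟨_, rfl⟩
  have := Φ.finrank_range_add_finrank_ker
  rw [hs, finrank_top, Module.finrank_fin_fun] at this
  omega

theorem finrank_le_of_comp_eq_zero {K U V W : Type*} [Field K] [AddCommGroup U] [Module K U]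
    [AddCommGroup V] [Module K V] [AddCommGroup W] [Module K W] [FiniteDimensional K U]
    [FiniteDimensional K V] (Γ : U →ₗ[K] V) (Λ : V →ₗ[K] W) (h : ∀ u, Λ (Γ u) = 0) :
    Module.finrank K U ≤ Module.finrank K (LinearMap.ker Γ) +
      Module.finrank K (LinearMap.ker Λ) := by
  have hle : LinearMap.range Γ ≤ LinearMap.ker Λ := by
    rintro _ ⟨u, rfl⟩
    exact h u
  have := Submodule.finrank_mono hle
  have := Γ.finrank_range_add_finrank_ker
  omega

theorem finrank_fun {K V : Type*} [Field K] [AddCommGroup V] [Module K V]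
    [FiniteDimensional K V] (n : ℕ) :
    Module.finrank K (Fin n → V) = n * Module.finrank K V := by
  simp [Module.finrank_pi_fintype]

/-! ### First order expansions of polynomials -/

/-- The dual number `a + b ε`. -/
def dual (a b : ℂ) : DualNumber ℂ := TrivSqZeroExt.inl a + TrivSqZeroExt.inr b

@[simp] theorem fst_dual (a b : ℂ) : (dual a b).fst = a := by simp [dual]

@[simp] theorem snd_dual (a b : ℂ) : (dual a b).snd = b := by simp [dual]

/-- Evaluation of polynomials at `a + t ε`. -/
def jet {n : ℕ} (a t : Fin n → ℂ) : Pl n →ₐ[ℂ] DualNumber ℂ := aeval fun i => dual (a i) (t i)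

theorem jet_X {n : ℕ} (a t : Fin n → ℂ) (i : Fin n) : jet a t (X i) = dual (a i) (t i) := by
  simp [jet]

theorem fst_jet {n : ℕ} (a t : Fin n → ℂ) (F : Pl n) : (jet a t F).fst = eval a F := by
  have : (TrivSqZeroExt.fstHom ℂ ℂ ℂ).comp (jet a t) = aeval a := by
    ext i; simp [jet_X]
  simpa using DFunLike.congr_fun this F

theorem snd_jet {n : ℕ} (a t : Fin n → ℂ) (F : Pl n) :
    (jet a t F).snd = ∑ i, t i * eval a (pderiv i F) := by
  induction F using MvPolynomial.induction_on with
  | C c => simp [← algebraMap_eq, TrivSqZeroExt.algebraMap_eq_inl]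
  | add p q hp hq => simp [hp, hq, mul_add, Finset.sum_add_distrib]
  | mul_X p i hp =>
    simp only [map_mul, DualNumber.snd_mul, fst_jet, hp, jet_X, fst_dual, snd_dual,
      Derivation.leibniz, smul_eq_mul, map_add, eval_X, pderiv_X, mul_add, Finset.sum_add_distrib]
    congr 1
    · rw [Finset.sum_eq_single i] <;> simp +contextual [mul_comm, eq_comm]
    · rw [Finset.sum_mul]; exact Finset.sum_congr rfl fun j _ => by ring

theorem jet_aeval {m n : ℕ} (x v : Fin m → ℂ) (A : Fin n → Pl m) (F : Pl n) :
    jet x v (aeval A F) =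
      jet (fun i => (jet x v (A i)).fst) (fun i => (jet x v (A i)).snd) F := by
  have : (jet x v).comp (aeval A) =
      jet (fun i => (jet x v (A i)).fst) (fun i => (jet x v (A i)).snd) := by
    ext i <;> simp [jet_X]
  exact DFunLike.congr_fun this F

theorem fst_mon_dual (Y : Fin 6 → DualNumber ℂ) (l : List (Fin 6)) :
    (mon Y l).fst = mon (fun i => (Y i).fst) l := by
  exact map_mon (TrivSqZeroExt.fstHom ℂ ℂ ℂ).toRingHom Y l

theorem snd_mon_dual (Y : Fin 6 → DualNumber ℂ) (l : List (Fin 6)) :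
    (mon Y l).snd = dmon (fun i => (Y i).fst) (fun i => (Y i).snd) l := by
  induction l with
  | nil => simp [mon, dmon]
  | cons i l ih =>
    have h : mon Y (i :: l) = Y i * mon Y l := by simp [mon]
    rw [h, DualNumber.snd_mul, ih, fst_mon_dual, dmon, add_comm]

theorem surf_dual (P : Fin 8 × Fin 3 → ℂ) (w : Fin 7 → ℂ) (x v : Fin 3 → ℂ) (i : Fin 6) :
    surf (-1) (fun q => TrivSqZeroExt.inl (P q)) (fun k => TrivSqZeroExt.inl (w k))
      (fun j => dual (x j) (v j)) i = dual (surf (-1) P w x i) (dsurf (-1) P w x v i) := by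
  have hl (a b) : line (-1 : DualNumber ℂ) (fun q => TrivSqZeroExt.inl (P q)) a b
      (fun j => dual (x j) (v j)) = dual (line (-1) P a b x) (line (-1) P a b v) := by
    ext <;> simp [line, bracket]
  have hq (k) : quart (-1 : DualNumber ℂ) (fun q => TrivSqZeroExt.inl (P q)) k
      (fun j => dual (x j) (v j)) = dual (quart (-1) P k x) (dquart (-1) P k x v) := by
    simp only [quart, hl]
    ext
    · simp
    · simp [dquart]; ring
  ext <;> simp [surf, dsurf, proj, hq]

/-- The polynomials parametrizing the projected surface. -/
def surfPoly (P : Fin 8 × Fin 3 → ℂ) (w : Fin 7 → ℂ) : Fin 6 → Pl 3 :=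
  surf (-1) (fun q => C (P q)) (fun k => C (w k)) X

theorem eval_surfPoly (P : Fin 8 × Fin 3 → ℂ) (w : Fin 7 → ℂ) (x : Fin 3 → ℂ) (i : Fin 6) :
    eval x (surfPoly P w i) = surf (-1) P w x i := by
  have := congrFun (map_surf (eval x) (-1) (fun q => C (P q)) (fun k => C (w k)) X) i
  simpa [Function.comp_def, surfPoly] using this

theorem jet_surfPoly (P : Fin 8 × Fin 3 → ℂ) (w : Fin 7 → ℂ) (x v : Fin 3 → ℂ) (i : Fin 6) :
    jet x v (surfPoly P w i) = dual (surf (-1) P w x i) (dsurf (-1) P w x v i) := by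
  rw [← surf_dual]
  have := congrFun (map_surf (jet x v).toRingHom (-1) (fun q => C (P q)) (fun k => C (w k)) X) i
  simpa [Function.comp_def, surfPoly, jet_X, ← algebraMap_eq, TrivSqZeroExt.algebraMap_eq_inl]
    using this

theorem length_planeCodes : planeCodes.length = 80 := by decide +kernel

theorem length_quinticCodes : quinticCodes.length = 247 := by decide +kernel

theorem length_quarticCodes : quarticCodes.length = 191 := by decide +kernel

theorem planeExp_sum (i : Fin planeCodes.length) : ∑ j, planeExp (planeCodes.get i) j = 16 := by
  revert i
  decide +kernel

attribute [irreducible] planeCodes quinticCodes quarticCodes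

/-! ### Quintic forms which are singular along a projected surface -/

/-- The quintic forms whose partial derivatives vanish at the points `a x`. -/
def doubleAlong (a : (Fin 3 → ℂ) → Fin 6 → ℂ) : Submodule ℂ (Pl 6) :=
  homogeneousSubmodule (Fin 6) ℂ 5 ⊓
    ⨅ (x) (i), LinearMap.ker ((aeval (R := ℂ) (a x)).toLinearMap ∘ₗ (pderiv i).toLinearMap)

theorem mem_doubleAlong {a : (Fin 3 → ℂ) → Fin 6 → ℂ} {F : Pl 6} :
    F ∈ doubleAlong a ↔ F.IsHomogeneous 5 ∧ ∀ x i, eval (a x) (pderiv i F) = 0 := by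
  simp [doubleAlong, Submodule.mem_iInf, aeval_eq_eval]

theorem isHomogeneous_mon {n d : ℕ} {A : Fin 6 → Pl n} (hA : ∀ i, (A i).IsHomogeneous d)
    (l : List (Fin 6)) : (mon A l).IsHomogeneous (d * l.length) := by
  induction l with
  | nil => simpa [mon] using isHomogeneous_one _ _
  | cons i l ih =>
    have := (hA i).mul ih
    simpa [mon, mul_add, add_comm] using this

theorem finrank_doubleAlong_le {P : Fin 8 × Fin 3 → ℂ} {w : Fin 7 → ℂ}
    (h : (quinticMat P w).det ≠ 0) : Module.finrank ℂ (doubleAlong (surf (-1) P w)) ≤ 5 := by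
  let Φ : homogeneousSubmodule (Fin 6) ℂ 5 →ₗ[ℂ] (Fin quinticCodes.length → ℂ) :=
    LinearMap.pi fun c => TrivSqZeroExt.sndHom ℂ ℂ ∘ₗ
      (jet (surf (-1) P w fun j => (sample (c.1 / 3) j : ℂ))
        fun j => (digitVec (10 ^ (c.1 % 6)) j : ℂ)).toLinearMap ∘ₗ Submodule.subtype _
  have hΦ (F : homogeneousSubmodule (Fin 6) ℂ 5) (c) : Φ F c =
      (jet (surf (-1) P w fun j => (sample (c.1 / 3) j : ℂ))
        (fun j => (digitVec (10 ^ (c.1 % 6)) j : ℂ)) F.1).snd := rfl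
  have hm (N : ℕ) : (mon (X : Fin 6 → Pl 6) (sixits 5 N)).IsHomogeneous 5 := by
    have := isHomogeneous_mon (fun i : Fin 6 => isHomogeneous_X ℂ i) (sixits 5 N)
    rwa [length_sixits] at this
  have key := finrank_ker_add Φ
    (fun i => ⟨mon X (sixits 5 (quinticCodes.get i)), hm _⟩) h (fun i c => by
      simp only [hΦ, quinticMat, Matrix.of_apply]
      rw [← AlgHom.coe_toRingHom, map_mon, snd_mon_dual]
      simp only [Function.comp_def, AlgHom.coe_toRingHom, jet_X, fst_dual, snd_dual])
  rw [finrank_forms, show Nat.choose (6 + 5 - 1) 5 = 252 from rfl] at key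
  have hl := length_quinticCodes
  replace key : Module.finrank ℂ (LinearMap.ker Φ) ≤ 5 := by omega
  have hle : doubleAlong (surf (-1) P w) ≤ (LinearMap.ker Φ).map (Submodule.subtype _) := by
    intro F hF
    rw [mem_doubleAlong] at hF
    refine ⟨⟨F, hF.1⟩, ?_, rfl⟩
    ext c
    simp [hΦ, snd_jet, hF.2]
  refine (Submodule.finrank_mono hle).trans ?_
  rw [Submodule.finrank_map_subtype_eq]
  exact key

/-- The substitution `f(x) ↦ f(a + x)`. -/
def shift {n : ℕ} (a : Fin n → ℂ) : Pl n →ₐ[ℂ] Pl n := aeval fun j => C (a j) + X j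

theorem coeff_shift_monomial (a : Fin 3 → ℂ) (e d : Fin 3 → ℕ) :
    coeff (Finsupp.equivFunOnFinite.symm d)
      (shift a (monomial (Finsupp.equivFunOnFinite.symm e) 1)) = taylorCoeff a e d := by
  have hp (p : Fin 3 → ℕ) :
      ∏ j, ((X j : Pl 3) ^ p j * C (a j) ^ (e j - p j) * ((e j).choose (p j) : Pl 3)) =
        monomial (Finsupp.equivFunOnFinite.symm p) (taylorCoeff a e p) := by
    rw [Finset.prod_mul_distrib, Finset.prod_mul_distrib, monomial_eq,
      Finsupp.prod_fintype _ _ (by simp), taylorCoeff, Finset.prod_mul_distrib]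
    simp only [map_mul, map_prod, map_pow, map_natCast, Finsupp.coe_equivFunOnFinite_symm]
    ring
  simp only [shift, aeval_monomial, map_one, one_mul]
  rw [Finsupp.prod_fintype _ _ (by simp)]
  simp only [Finsupp.coe_equivFunOnFinite_symm, add_comm (C _), add_pow]
  rw [Finset.prod_univ_sum]
  simp only [hp, coeff_sum, coeff_monomial, EmbeddingLike.apply_eq_iff_eq]
  rw [Finset.sum_ite_eq']
  split_ifs with h
  · rfl
  · simp only [Fintype.mem_piFinset, Finset.mem_range, not_forall, not_lt] at h
    obtain ⟨j, hj⟩ := h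
    refine (Finset.prod_eq_zero (Finset.mem_univ j) ?_).symm
    rw [Nat.choose_eq_zero_of_lt (by omega)]
    simp

/-- The Taylor coefficients of order `3` at the eight points. -/
def cubicJets (P : Fin 8 × Fin 3 → ℂ) :
    homogeneousSubmodule (Fin 3) ℂ 16 →ₗ[ℂ] (Fin planeCodes.length → ℂ) :=
  LinearMap.pi fun c => lcoeff ℂ (Finsupp.equivFunOnFinite.symm (cubicExp (c.1 % 10))) ∘ₗ
    (shift fun j => P (Fin.ofNat 8 (c.1 / 10), j)).toLinearMap ∘ₗ Submodule.subtype _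

theorem cubicJets_apply (P : Fin 8 × Fin 3 → ℂ) (f : homogeneousSubmodule (Fin 3) ℂ 16)
    (c : Fin planeCodes.length) :
    cubicJets P f c = coeff (Finsupp.equivFunOnFinite.symm (cubicExp (c.1 % 10)))
      (shift (fun j => P (Fin.ofNat 8 (c.1 / 10), j)) f) := rfl

theorem cubicExp_sum (c : Fin 10) : ∑ j, cubicExp c j = 3 := by
  revert c
  decide +kernel

theorem finrank_ker_cubicJets {P : Fin 8 × Fin 3 → ℂ} (h : (planeMat P).det ≠ 0) :
    Module.finrank ℂ (LinearMap.ker (cubicJets P)) = 73 := by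
  have key := finrank_ker_add (cubicJets P)
    (fun i => ⟨monomial (Finsupp.equivFunOnFinite.symm (planeExp (planeCodes.get i))) 1,
      isHomogeneous_monomial _ (by
        rw [Finsupp.degree_eq_sum]; exact planeExp_sum i)⟩) h (fun i c => by
      simp only [Matrix.of_apply, cubicJets_apply, coeff_shift_monomial, planeMat])
  rw [finrank_forms, show Nat.choose (3 + 16 - 1) 16 = 153 from rfl] at key
  have := length_planeCodes
  omega

theorem aeval_mem_pow {n m d : ℕ} {I : Ideal (Pl m)} {g : Fin n → Pl m} (hg : ∀ i, g i ∈ I)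
    {H : Pl n} (hH : H.IsHomogeneous d) : aeval g H ∈ I ^ d := by
  rw [aeval_def, eval₂_eq]
  refine Ideal.sum_mem _ fun e he => Ideal.mul_mem_left _ _ ?_
  have hd : ∑ i ∈ e.support, e i = d := by
    have := hH (mem_support_iff.1 he)
    simpa [Finsupp.weight_apply, Finsupp.sum] using this
  rw [← hd, ← Finset.prod_pow_eq_pow_sum]
  exact Ideal.prod_mem_prod fun i _ => Ideal.pow_mem_pow (hg i) _

theorem mem_pair_rot (q : Fin 8) (k : Fin 7) :
    (q = 7 ∨ q = rot k 0) ∨ (q = rot k 1 ∨ q = rot k 6) ∨ (q = rot k 2 ∨ q = rot k 5) ∨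
      (q = rot k 3 ∨ q = rot k 4) := by
  revert q k
  decide +kernel

theorem line_eq_zero {R : Type*} [CommRing R] (P : Fin 8 × Fin 3 → R) {a b q : Fin 8}
    (h : q = a ∨ q = b) : line (-1) P a b (fun j => P (q, j)) = 0 := by
  obtain rfl | rfl := h <;> (simp only [line, bracket]; ring)

theorem quart_eq_zero {R : Type*} [CommRing R] (P : Fin 8 × Fin 3 → R) (q : Fin 8) (k : Fin 7) :
    quart (-1) P k (fun j => P (q, j)) = 0 := by
  obtain h | h | h | h := mem_pair_rot q k <;> simp [quart, line_eq_zero P h]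

/-- The quartics through the eight points, as polynomials. -/
def quartPoly (P : Fin 8 × Fin 3 → ℂ) (k : Fin 7) : Pl 3 := quart (-1) (fun q => C (P q)) k X

theorem eval_quartPoly (P : Fin 8 × Fin 3 → ℂ) (k : Fin 7) (x : Fin 3 → ℂ) :
    eval x (quartPoly P k) = quart (-1) P k x := by
  have := map_quart (eval x) (-1) (fun q => C (P q)) k X
  simpa [Function.comp_def, quartPoly] using this

theorem isHomogeneous_line (P : Fin 8 × Fin 3 → ℂ) (a b : Fin 8) :
    (line (-1) (fun q => C (P q)) a b (X : Fin 3 → Pl 3)).IsHomogeneous 1 := by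
  have h (c : ℂ) (p : Pl 3) (hp : p.IsHomogeneous 1) : (C c * p).IsHomogeneous 1 := by
    simpa using (isHomogeneous_C _ c).mul hp
  have h' (p : Pl 3) (hp : p.IsHomogeneous 1) : ((-1) * p).IsHomogeneous 1 := by
    simpa using hp.neg
  have hX (i : Fin 3) := isHomogeneous_X ℂ i
  simp only [line, bracket]
  refine ((h _ _ ?_).add (h _ _ ?_)).add (h _ _ ?_) <;>
    exact (h _ _ (hX _)).add (h' _ (h _ _ (hX _)))

theorem isHomogeneous_quartPoly (P : Fin 8 × Fin 3 → ℂ) (k : Fin 7) :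
    (quartPoly P k).IsHomogeneous 4 := by
  have h := isHomogeneous_line P
  exact ((h _ _).mul (h _ _)).mul ((h _ _).mul (h _ _))

theorem surfPoly_eq (P : Fin 8 × Fin 3 → ℂ) (w : Fin 7 → ℂ) (i : Fin 6) :
    surfPoly P w i = C (w 6) * quartPoly P i.castSucc - C (w i.castSucc) * quartPoly P 6 := by
  simp [surfPoly, surf, proj, quartPoly, sub_eq_add_neg]

theorem isHomogeneous_surfPoly (P : Fin 8 × Fin 3 → ℂ) (w : Fin 7 → ℂ) (i : Fin 6) :
    (surfPoly P w i).IsHomogeneous 4 := by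
  have h (c k) : (C c * quartPoly P k).IsHomogeneous 4 := by
    simpa using (isHomogeneous_C _ c).mul (isHomogeneous_quartPoly P k)
  rw [surfPoly_eq]
  exact (h _ _).sub (h _ _)

theorem shift_surfPoly_mem (P : Fin 8 × Fin 3 → ℂ) (w : Fin 7 → ℂ) (q : Fin 8) (i : Fin 6) :
    shift (fun j => P (q, j)) (surfPoly P w i) ∈ idealOfVars (Fin 3) ℂ := by
  have h (H : Pl 3) : coeff 0 (shift (fun j => P (q, j)) H) = eval (fun j => P (q, j)) H := by
    have : (constantCoeff (R := ℂ)).comp (shift fun j => P (q, j)).toRingHom =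
        eval fun j => P (q, j) := by
      apply MvPolynomial.ringHom_ext
      · intro c
        simp [shift]
      · intro j
        simp [shift]
    exact DFunLike.congr_fun this H
  rw [← pow_one (idealOfVars _ _), mem_pow_idealOfVars_iff']
  intro e he
  obtain rfl : e = 0 := by simpa [Finsupp.degree_eq_zero_iff] using he
  rw [h, surfPoly_eq]
  simp [eval_quartPoly, quart_eq_zero]

theorem aeval_surfPoly_mem (P : Fin 8 × Fin 3 → ℂ) (w : Fin 7 → ℂ) {H : Pl 6}
    (hH : H.IsHomogeneous 4) :
    ∃ h : (aeval (surfPoly P w) H).IsHomogeneous 16,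
      ⟨aeval (surfPoly P w) H, h⟩ ∈ LinearMap.ker (cubicJets P) := by
  refine ⟨hH.aeval _ (isHomogeneous_surfPoly P w), ?_⟩
  ext c
  rw [cubicJets_apply]
  set a := fun j => P (Fin.ofNat 8 (c.1 / 10), j)
  have h : aeval (fun i => shift a (surfPoly P w i)) H ∈ idealOfVars (Fin 3) ℂ ^ 4 :=
    aeval_mem_pow (shift_surfPoly_mem P w _) hH
  rw [mem_pow_idealOfVars_iff'] at h
  have hc : (shift a).comp (aeval (surfPoly P w)) = aeval fun i => shift a (surfPoly P w i) := by
    ext i; simp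
  have := DFunLike.congr_fun hc H
  rw [AlgHom.comp_apply] at this
  rw [this]
  refine h _ ?_
  rw [Finsupp.degree_eq_sum]
  have := cubicExp_sum ⟨c.1 % 10, Nat.mod_lt _ (by norm_num)⟩
  simp only [Finsupp.coe_equivFunOnFinite_symm] at this ⊢
  omega

/-- The gradient of a quintic form, restricted to the surface. -/
def gradOn (P : Fin 8 × Fin 3 → ℂ) (w : Fin 7 → ℂ) :
    homogeneousSubmodule (Fin 6) ℂ 5 →ₗ[ℂ] (Fin 6 → LinearMap.ker (cubicJets P)) :=
  LinearMap.pi fun i => LinearMap.codRestrict _ (LinearMap.codRestrict _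
    ((aeval (surfPoly P w)).toLinearMap ∘ₗ (pderiv i).toLinearMap ∘ₗ Submodule.subtype _)
    fun F => (aeval_surfPoly_mem P w (IsHomogeneous.pderiv F.2)).1)
    fun F => (aeval_surfPoly_mem P w (IsHomogeneous.pderiv F.2)).2

theorem gradOn_apply (P : Fin 8 × Fin 3 → ℂ) (w : Fin 7 → ℂ)
    (F : homogeneousSubmodule (Fin 6) ℂ 5) (i : Fin 6) :
    (gradOn P w F i : Pl 3) = aeval (surfPoly P w) (pderiv i F.1) := rfl

theorem eval_aeval_surfPoly (P : Fin 8 × Fin 3 → ℂ) (w : Fin 7 → ℂ) (H : Pl 6) (x : Fin 3 → ℂ) :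
    eval x (aeval (surfPoly P w) H) = eval (surf (-1) P w x) H := by
  have : (aeval x).comp (aeval (surfPoly P w)) = aeval (R := ℂ) (surf (-1) P w x) := by
    ext i; simp [aeval_eq_eval, eval_surfPoly]
  simpa [aeval_eq_eval] using DFunLike.congr_fun this H

theorem map_ker_gradOn (P : Fin 8 × Fin 3 → ℂ) (w : Fin 7 → ℂ) :
    (LinearMap.ker (gradOn P w)).map (Submodule.subtype _) = doubleAlong (surf (-1) P w) := by
  have h (F : homogeneousSubmodule (Fin 6) ℂ 5) :
      F ∈ LinearMap.ker (gradOn P w) ↔ ∀ x i, eval (surf (-1) P w x) (pderiv i F.1) = 0 := by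
    rw [LinearMap.mem_ker, funext_iff, forall_comm]
    refine forall_congr' fun i => ?_
    rw [← Subtype.coe_inj, ← Subtype.coe_inj, gradOn_apply]
    simp only [← eval_aeval_surfPoly]
    refine ⟨fun h x => by rw [h]; simp, fun h => MvPolynomial.funext fun x => by rw [h]; simp⟩
  ext F
  rw [mem_doubleAlong]
  constructor
  · rintro ⟨F, hF, rfl⟩
    exact ⟨F.2, (h F).1 hF⟩
  · exact fun hF => ⟨⟨F, hF.1⟩, (h _).2 hF.2, rfl⟩

theorem pderiv_comm {n : ℕ} (i j : Fin n) (F : Pl n) :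
    pderiv i (pderiv j F) = pderiv j (pderiv i F) := by
  have : ⁅(pderiv i : Derivation ℂ (Pl n) (Pl n)), (pderiv j : Derivation ℂ (Pl n) (Pl n))⁆ = 0 := by
    ext k; simp [Derivation.commutator_apply, pderiv_X, Pi.single_apply, apply_ite]
  have := DFunLike.congr_fun this F
  rwa [Derivation.commutator_apply, Derivation.zero_apply, sub_eq_zero] at this

theorem euler_eval {n d : ℕ} {H : Pl n} (hH : H.IsHomogeneous d) (a : Fin n → ℂ) :
    ∑ i, a i * eval a (pderiv i H) = d * eval a H := by
  simpa using congrArg (eval a) hH.sum_X_mul_pderiv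

/-- Euler's relation for the gradient of a quintic form along a curve. -/
theorem grad_relation {n : ℕ} {F : Pl n} (hF : F.IsHomogeneous 5) (a t : Fin n → ℂ) :
    ∑ i, (4 * t i * eval a (pderiv i F) - a i * (jet a t (pderiv i F)).snd) = 0 := by
  simp only [snd_jet, Finset.sum_sub_distrib, Finset.mul_sum]
  rw [Finset.sum_comm (f := fun i j => a i * _), sub_eq_zero]
  refine Finset.sum_congr rfl fun j _ => ?_
  have := euler_eval (IsHomogeneous.pderiv (i := j) hF) a
  norm_num at this
  rw [mul_right_comm, ← this, Finset.sum_mul]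
  refine Finset.sum_congr rfl fun i _ => ?_
  rw [pderiv_comm]
  ring

/-- Functionals which vanish on the gradients of quintic forms. -/
def eulerDefect (P : Fin 8 × Fin 3 → ℂ) (w : Fin 7 → ℂ) :
    (Fin 6 → LinearMap.ker (cubicJets P)) →ₗ[ℂ] (Fin quarticCodes.length → ℂ) where
  toFun G c :=
    let x : Fin 3 → ℂ := fun j => sample (c.1 / 2) j
    let v : Fin 3 → ℂ := fun j => digitVec (10 ^ (c.1 % 2)) j
    ∑ i, (4 * dsurf (-1) P w x v i * eval x (G i : Pl 3) -
      surf (-1) P w x i * (jet x v (G i : Pl 3)).snd)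
  map_add' G H := by
    ext c
    simp only [Pi.add_apply, Submodule.coe_add, map_add, TrivSqZeroExt.snd_add,
      ← Finset.sum_add_distrib]
    exact Finset.sum_congr rfl fun i _ => by ring
  map_smul' r G := by
    ext c
    simp only [Pi.smul_apply, Submodule.coe_smul, map_smul, TrivSqZeroExt.snd_smul, smul_eval,
      smul_eq_mul, RingHom.id_apply, Finset.mul_sum]
    exact Finset.sum_congr rfl fun i _ => by ring

theorem finrank_ker_eulerDefect {P : Fin 8 × Fin 3 → ℂ} {w : Fin 7 → ℂ}
    (h : (planeMat P).det ≠ 0) (h' : (quarticMat P w).det ≠ 0) :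
    Module.finrank ℂ (LinearMap.ker (eulerDefect P w)) = 247 := by
  have hm (N : ℕ) : (mon (X : Fin 6 → Pl 6) (sixits 4 N)).IsHomogeneous 4 := by
    have := isHomogeneous_mon (fun i : Fin 6 => isHomogeneous_X ℂ i) (sixits 4 N)
    rwa [length_sixits] at this
  let u (N : ℕ) : LinearMap.ker (cubicJets P) := ⟨_, (aeval_surfPoly_mem P w (hm N)).2⟩
  have hu (N) : (u N : Pl 3) = mon (surfPoly P w) (sixits 4 N) := by
    change aeval (surfPoly P w) (mon X (sixits 4 N)) = _
    rw [← AlgHom.coe_toRingHom, map_mon]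
    congr 1
    ext i; simp
  have key := finrank_ker_add (V := Fin 6 → LinearMap.ker (cubicJets P)) (eulerDefect P w)
    (fun i => Pi.single (Fin.ofNat 6 (quarticCodes.get i / 1296)) (u (quarticCodes.get i))) h'
    (fun i c => by
      simp only [Matrix.of_apply, eulerDefect, LinearMap.coe_mk, AddHom.coe_mk, quarticMat]
      rw [Finset.sum_eq_single (Fin.ofNat 6 (quarticCodes.get i / 1296))]
      · rw [Pi.single_eq_same, hu, map_mon, ← AlgHom.coe_toRingHom, map_mon, snd_mon_dual]
        simp only [Function.comp_def, eval_surfPoly, AlgHom.coe_toRingHom, jet_surfPoly, fst_dual,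
          snd_dual]
        ring
      · intro j _ hj
        simp only [Pi.single_eq_of_ne hj, Submodule.coe_zero, map_zero, TrivSqZeroExt.snd_zero,
          mul_zero, sub_zero]
      · simp)
  have hW := finrank_fun (K := ℂ) (V := LinearMap.ker (cubicJets P)) 6
  rw [finrank_ker_cubicJets h] at hW
  have hl := length_quarticCodes
  exact Nat.add_right_cancel (m := quarticCodes.length) (key.trans (hW.trans (by omega)))

theorem finrank_doubleAlong_surf {P : Fin 8 × Fin 3 → ℂ} {w : Fin 7 → ℂ}
    (h : genericity P w ≠ 0) : Module.finrank ℂ (doubleAlong (surf (-1) P w)) = 5 := by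
  simp only [genericity, mul_ne_zero_iff] at h
  obtain ⟨⟨⟨⟨-, h1⟩, h2⟩, h3⟩, -⟩ := h
  refine le_antisymm (finrank_doubleAlong_le h2) ?_
  have key := finrank_le_of_comp_eq_zero (U := homogeneousSubmodule (Fin 6) ℂ 5)
    (V := Fin 6 → LinearMap.ker (cubicJets P)) (gradOn P w) (eulerDefect P w) fun F => by
      ext c
      simp only [eulerDefect, LinearMap.coe_mk, AddHom.coe_mk, gradOn_apply, eval_aeval_surfPoly,
        jet_aeval, jet_surfPoly, fst_dual, snd_dual]
      exact grad_relation F.2 _ _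
  have hd := (finrank_forms 6 5).symm.trans_le
    (key.trans_eq (congrArg _ (finrank_ker_eulerDefect h1 h3)))
  rw [← map_ker_gradOn, Submodule.finrank_map_subtype_eq]
  exact Nat.le_of_add_le_add_right (b := 247) ((show 5 + 247 ≤ 252 by norm_num).trans hd)

/-! ### Homogeneous polynomials and closures of cones -/

theorem eval_smul_of_isHomogeneous {n d : ℕ} {H : Pl n} (hH : H.IsHomogeneous d) (c : ℂ)
    (v : Fin n → ℂ) : eval (c • v) H = c ^ d * eval v H := by
  rw [eval_eq', eval_eq', Finset.mul_sum]
  refine Finset.sum_congr rfl fun e he => ?_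
  have : e.degree = d := by
    rw [Finsupp.degree_eq_weight_one]
    exact hH (mem_support_iff.1 he)
  rw [Finsupp.degree_eq_sum] at this
  simp only [Pi.smul_apply, smul_eq_mul, mul_pow, Finset.prod_mul_distrib,
    Finset.prod_pow_eq_pow_sum, this]
  ring

theorem eval_eq_zero_of_mk_mem {n d : ℕ} {A : Set (Pr n)} {F : Pl (n + 1)}
    (hF : F.IsHomogeneous d) (h : ∀ x ∈ A, ∃ u, ∃ hu : u ≠ 0, Projectivization.mk ℂ u hu = x ∧
      eval u F = 0) {v : Fin (n + 1) → ℂ} (hv : v ∈ cone (algClosure A)) : eval v F = 0 := by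
  obtain ⟨hv0, hm⟩ := hv
  refine hm (zeroSet {F}) ⟨⟨{F}, by simpa using ⟨d, hF⟩, rfl⟩, ?_⟩ F rfl v ⟨hv0, rfl⟩
  rintro x hx _ rfl w ⟨hw, hwx⟩
  obtain ⟨u, hu, rfl, hu'⟩ := h x hx
  obtain ⟨c, rfl⟩ := (Projectivization.mk_eq_mk_iff' ..).1 (Set.mem_singleton_iff.1 hwx)
  rw [eval_smul_of_isHomogeneous hF, hu', mul_zero]

theorem subset_algClosure {n : ℕ} (A : Set (Pr n)) : A ⊆ algClosure A :=
  fun _ hx _ hZ => hZ.2 hx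

theorem eval_eq_zero_of_imClos {m n d : ℕ} {b : Fin (n + 1) → Pl m} {F : Pl (n + 1)}
    (hF : F.IsHomogeneous d) (h : ∀ x, eval (fun i => eval x (b i)) F = 0)
    {v : Fin (n + 1) → ℂ} (hv : v ∈ cone (imClos b)) : eval v F = 0 := by
  refine eval_eq_zero_of_mk_mem hF ?_ hv
  rintro _ ⟨x, hx, rfl⟩
  exact ⟨_, hx, rfl, h x⟩

theorem eval_eq_zero_of_projIm {m n d : ℕ} {L : (Fin (m + 1) → ℂ) →ₗ[ℂ] (Fin (n + 1) → ℂ)}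
    {Z : Set (Pr m)} {F : Pl (n + 1)} (hF : F.IsHomogeneous d)
    (h : ∀ u ∈ cone Z, eval (L u) F = 0) {v : Fin (n + 1) → ℂ} (hv : v ∈ cone (projIm L Z)) :
    eval v F = 0 := by
  refine eval_eq_zero_of_mk_mem hF ?_ hv
  rintro _ ⟨u, hu, hL, rfl⟩
  exact ⟨_, hL, rfl, h u hu⟩

/-- Composition of a polynomial with a linear map. -/
def compLin {m n : ℕ} (L : (Fin m → ℂ) →ₗ[ℂ] (Fin n → ℂ)) : Pl n →ₐ[ℂ] Pl m :=
  aeval fun i => ∑ j, C (L (Pi.single j 1) i) * X j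

theorem eval_linear {m n : ℕ} (L : (Fin m → ℂ) →ₗ[ℂ] (Fin n → ℂ)) (v : Fin m → ℂ) (i : Fin n) :
    eval v (∑ j, C (L (Pi.single j 1) i) * X j) = L v i := by
  conv_rhs => rw [pi_eq_sum_univ' v]
  simp [mul_comm]

theorem eval_compLin {m n : ℕ} (L : (Fin m → ℂ) →ₗ[ℂ] (Fin n → ℂ)) (v : Fin m → ℂ) (F : Pl n) :
    eval v (compLin L F) = eval (L v) F := by
  have : (aeval v : Pl m →ₐ[ℂ] ℂ).comp (compLin L) = aeval (L v) := by
    ext i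
    simpa [compLin, aeval_eq_eval] using eval_linear L v i
  simpa [aeval_eq_eval] using DFunLike.congr_fun this F

theorem isHomogeneous_compLin {m n d : ℕ} (L : (Fin m → ℂ) →ₗ[ℂ] (Fin n → ℂ)) {F : Pl n}
    (hF : F.IsHomogeneous d) : (compLin L F).IsHomogeneous d := by
  have := hF.aeval (fun i => ∑ j, C (L (Pi.single j 1) i) * (X j : Pl m)) (n := 1) fun i =>
    IsHomogeneous.sum _ _ _ fun j _ => by
      simpa using (isHomogeneous_C _ _).mul (isHomogeneous_X _ j)
  rwa [one_mul] at this

theorem eval_pderiv_compLin {m n : ℕ} (L : (Fin m → ℂ) →ₗ[ℂ] (Fin n → ℂ)) (v : Fin m → ℂ)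
    (i : Fin m) (F : Pl n) : eval v (pderiv i (compLin L F)) =
      ∑ j, L (Pi.single i 1) j * eval (L v) (pderiv j F) := by
  have h (t : Fin m → ℂ) (j : Fin n) : jet v t (∑ k, C (L (Pi.single k 1) j) * X k) =
      dual (L v j) (L t j) := by
    ext
    · rw [fst_jet, eval_linear, fst_dual]
    · rw [snd_jet, snd_dual, ← eval_linear]
      simp [pderiv_X, Pi.single_apply, mul_comm]
  have := congrArg TrivSqZeroExt.snd
    (jet_aeval v (Pi.single i 1) (fun j => ∑ k, C (L (Pi.single k 1) j) * X k) F)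
  simp only [h, fst_dual, snd_dual] at this
  rw [snd_jet, snd_jet] at this
  simpa [compLin, Pi.single_apply] using this

theorem linSys_projIm {n : ℕ} (b : Fin (n + 1) → Pl 3)
    (L : (Fin (n + 1) → ℂ) →ₗ[ℂ] (Fin 6 → ℂ)) :
    linSys 5 2 (projIm L (imClos b)) = doubleAlong fun x => L fun i => eval x (b i) := by
  ext F
  rw [mem_doubleAlong]
  have hmem : F ∈ linSys 5 2 (projIm L (imClos b)) ↔ F.IsHomogeneous 5 ∧
      ∀ l : List (Fin 6), l.length < 2 → ∀ v ∈ cone (projIm L (imClos b)),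
        eval v (diffOp l F) = 0 := by
    simp [linSys, linSysV, Submodule.mem_iInf, aeval_eq_eval]
  rw [hmem]
  refine and_congr_right fun hF => ⟨fun h x i => ?_, fun h => ?_⟩
  · by_cases hL : L (fun i => eval x (b i)) = 0
    · have := eval_smul_of_isHomogeneous (IsHomogeneous.pderiv (i := i) hF) 0 0
      rw [hL]
      simpa using this
    · refine h [i] (by simp) _ ⟨hL, subset_algClosure _ ⟨_, ⟨?_, ?_⟩, hL, rfl⟩⟩
      · exact fun h0 => hL (by rw [h0, map_zero])
      · exact subset_algClosure _ ⟨x, _, rfl⟩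
  · have key {d : ℕ} {G : Pl 6} (hG : G.IsHomogeneous d)
        (h : ∀ x, eval (L fun i => eval x (b i)) G = 0) :
        ∀ v ∈ cone (projIm L (imClos b)), eval v G = 0 := by
      refine fun v => eval_eq_zero_of_projIm hG fun u hu => ?_
      rw [← eval_compLin]
      refine eval_eq_zero_of_imClos (isHomogeneous_compLin L hG) (fun x => ?_) hu
      rw [eval_compLin, h]
    rintro (_ | ⟨i, _ | ⟨j, l⟩⟩) hl
    · refine key hF fun x => ?_
      have := euler_eval hF (L fun i => eval x (b i))
      simpa [h, diffOp] using this
    · exact key (IsHomogeneous.pderiv hF) fun x => h x i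
    · simp at hl

instance (a : (Fin 3 → ℂ) → Fin 6 → ℂ) : Module.Finite ℂ (doubleAlong a) :=
  Submodule.finiteDimensional_of_le (S₂ := homogeneousSubmodule (Fin 6) ℂ 5) inf_le_left

theorem finrank_doubleAlong_comp_le (T : (Fin 6 → ℂ) ≃ₗ[ℂ] (Fin 6 → ℂ))
    (a : (Fin 3 → ℂ) → Fin 6 → ℂ) :
    Module.finrank ℂ (doubleAlong fun x => T (a x)) ≤ Module.finrank ℂ (doubleAlong a) := by
  have hT : Function.Injective (compLin T.toLinearMap).toLinearMap := fun F G h => by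
    refine MvPolynomial.funext fun v => ?_
    have h' : compLin T.toLinearMap F = compLin T.toLinearMap G := h
    simpa [eval_compLin] using congrArg (eval (T.symm v)) h'
  rw [(Submodule.equivMapOfInjective _ hT (doubleAlong fun x => T (a x))).finrank_eq]
  refine Submodule.finrank_mono ?_
  rintro _ ⟨F, hF, rfl⟩
  rw [SetLike.mem_coe, mem_doubleAlong] at hF
  refine mem_doubleAlong.2 ⟨isHomogeneous_compLin _ hF.1, fun x i => ?_⟩
  rw [AlgHom.toLinearMap_apply, eval_pderiv_compLin]
  simp [hF.2]

theorem finrank_doubleAlong_comp (T : (Fin 6 → ℂ) ≃ₗ[ℂ] (Fin 6 → ℂ))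
    (a : (Fin 3 → ℂ) → Fin 6 → ℂ) :
    Module.finrank ℂ (doubleAlong fun x => T (a x)) = Module.finrank ℂ (doubleAlong a) := by
  have h := finrank_doubleAlong_comp_le T.symm fun x => T (a x)
  rw [show (fun x => T.symm (T (a x))) = a from funext fun x => T.symm_apply_apply _] at h
  exact le_antisymm (finrank_doubleAlong_comp_le T a) h

/-! ### Projections of the octic surface in an arbitrary basis of quartics -/

theorem quartPoly_mem (P : Fin 8 × Fin 3 → ℂ) (k : Fin 7) :
    quartPoly P k ∈ linSysV 3 4 1 (Set.range fun i : Fin 8 => fun j => P (i, j)) := by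
  have hmem {F : Pl 3} {A : Set (Fin 3 → ℂ)} : F ∈ linSysV 3 4 1 A ↔ F.IsHomogeneous 4 ∧
      ∀ l : List (Fin 3), l.length < 1 → ∀ v ∈ A, eval v (diffOp l F) = 0 := by
    simp [linSysV, Submodule.mem_iInf, aeval_eq_eval]
  rw [hmem]
  refine ⟨isHomogeneous_quartPoly P k, ?_⟩
  rintro (_ | ⟨j, l⟩) hl _ ⟨i, rfl⟩
  · simpa [diffOp, eval_quartPoly] using quart_eq_zero P i k
  · simp at hl

theorem exists_quartPoly_eq {P : Fin 8 × Fin 3 → ℂ} (hP : (quartMat P).det ≠ 0) {b : Fin 7 → Pl 3}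
    (hb : IsBasisOf b (linSysV 3 4 1 (Set.range fun i : Fin 8 => fun j => P (i, j)))) :
    ∃ h : Matrix (Fin 7) (Fin 7) ℂ, h.det ≠ 0 ∧ ∀ k, quartPoly P k = ∑ i, h k i • b i := by
  have hs (k) : ∃ c : Fin 7 → ℂ, ∑ i, c i • b i = quartPoly P k := by
    rw [← Submodule.mem_span_range_iff_exists_fun, hb.2.2]
    exact quartPoly_mem P k
  choose h hh using hs
  refine ⟨Matrix.of h, fun h0 => hP ?_, fun k => (hh k).symm⟩
  have : quartMat P = Matrix.of h *
      Matrix.of fun i (c : Fin 7) => eval (fun j => (sample c j : ℂ)) (b i) := by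
    ext k c
    rw [quartMat, Matrix.of_apply, ← eval_quartPoly, ← hh k]
    simp [Matrix.mul_apply]
  rw [this, Matrix.det_mul, h0, zero_mul]

/-- A projection is determined by its centre, up to a linear automorphism of its target. -/
theorem exists_equiv_of_ker_eq {K U V : Type*} [Field K] [AddCommGroup U] [Module K U]
    [AddCommGroup V] [Module K V] {f g : U →ₗ[K] V} (hf : Function.Surjective f)
    (hg : Function.Surjective g) (h : LinearMap.ker f = LinearMap.ker g) :
    ∃ T : V ≃ₗ[K] V, ∀ u, g u = T (f u) := by
  refine ⟨(f.quotKerEquivOfSurjective hf).symm ≪≫ₗ Submodule.quotEquivOfEq _ _ h ≪≫ₗ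
    g.quotKerEquivOfSurjective hg, fun u => ?_⟩
  have : (f.quotKerEquivOfSurjective hf).symm (f u) = Submodule.Quotient.mk u := by
    rw [LinearEquiv.symm_apply_eq]
    rfl
  simp only [LinearEquiv.trans_apply, this]
  rfl

theorem h0_projIm_eq_five {P : Fin 8 × Fin 3 → ℂ} {b : Fin 7 → Pl 3}
    {h : Matrix (Fin 7) (Fin 7) ℂ} (hdet : h.det ≠ 0)
    (hb : ∀ k, quartPoly P k = ∑ i, h k i • b i) {w : Fin 7 → ℂ}
    (hg : genericity P (h.mulVec w) ≠ 0) {L : (Fin 7 → ℂ) →ₗ[ℂ] (Fin 6 → ℂ)}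
    (hL : Function.Surjective L) (hw : LinearMap.ker L = Submodule.span ℂ {w}) :
    h0 5 2 (projIm L (imClos (n := 6) b)) = 5 := by
  have h6 : h.mulVec w 6 ≠ 0 := right_ne_zero_of_mul hg
  have hinj : Function.Injective h.mulVec :=
    Matrix.mulVec_injective_of_isUnit ((Matrix.isUnit_iff_isUnit_det h).2 hdet.isUnit)
  let g : (Fin 7 → ℂ) →ₗ[ℂ] (Fin 6 → ℂ) :=
    { toFun := fun v => proj (-1) (h.mulVec w) (h.mulVec v)
      map_add' := fun u v => by ext i; simp [proj, Matrix.mulVec_add]; ring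
      map_smul' := fun c v => by ext i; simp [proj, Matrix.mulVec_smul]; ring }
  have hker : LinearMap.ker g = LinearMap.ker L := by
    ext v
    rw [hw, Submodule.mem_span_singleton, LinearMap.mem_ker]
    constructor
    · intro hv
      have hv' (i : Fin 6) : h.mulVec w 6 * h.mulVec v i.castSucc =
          h.mulVec w i.castSucc * h.mulVec v 6 := by
        have := congrFun hv i
        simp only [g, LinearMap.coe_mk, AddHom.coe_mk, proj, Pi.zero_apply] at this
        linear_combination this
      refine ⟨h.mulVec v 6 / h.mulVec w 6, hinj ?_⟩
      rw [Matrix.mulVec_smul]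
      ext i
      refine Fin.lastCases ?_ (fun i => ?_) i
      · exact div_mul_cancel₀ _ h6
      · rw [Pi.smul_apply, smul_eq_mul, div_mul_eq_mul_div, div_eq_iff h6]
        linear_combination -hv' i
    · rintro ⟨c, rfl⟩
      ext i
      simp only [g, LinearMap.coe_mk, AddHom.coe_mk, proj, Pi.zero_apply, Matrix.mulVec_smul,
        Pi.smul_apply, smul_eq_mul]
      ring
  have hsurj : Function.Surjective g := by
    rw [← LinearMap.range_eq_top]
    refine Submodule.eq_top_of_finrank_eq ?_
    have h1 := g.finrank_range_add_finrank_ker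
    rw [hker, ← L.finrank_range_add_finrank_ker, LinearMap.range_eq_top.2 hL, finrank_top] at h1
    exact Nat.add_right_cancel h1
  obtain ⟨T, hT⟩ := exists_equiv_of_ker_eq hsurj hL hker
  have key (x : Fin 3 → ℂ) : (L fun i => eval x (b i)) = T (surf (-1) P (h.mulVec w) x) := by
    rw [hT]
    refine congrArg T (congrArg (proj (-1) (h.mulVec w)) (funext fun k => ?_))
    rw [← eval_quartPoly, hb]
    simp [Matrix.mulVec, dotProduct]
  rw [h0, linSys_projIm, funext key, finrank_doubleAlong_comp, finrank_doubleAlong_surf hg]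

/-! ### An equation of the secant variety -/

theorem eval_homogeneousComponent_eq_zero {n : ℕ} {F : Pl n} {v : Fin n → ℂ}
    (h : ∀ s : ℂ, eval (s • v) F = 0) (d : ℕ) : eval v (homogeneousComponent d F) = 0 := by
  let p : Polynomial ℂ := ∑ e ∈ Finset.range (F.totalDegree + 1),
    Polynomial.C (eval v (homogeneousComponent e F)) * Polynomial.X ^ e
  have hp : p = 0 := Polynomial.funext fun s => by
    rw [Polynomial.eval_zero, ← h s, ← congrArg (eval (s • v)) (sum_homogeneousComponent F),
      map_sum, Polynomial.eval_finsetSum]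
    refine Finset.sum_congr rfl fun e _ => ?_
    rw [eval_smul_of_isHomogeneous (homogeneousComponent_isHomogeneous e F),
      Polynomial.eval_mul, Polynomial.eval_C, Polynomial.eval_pow, Polynomial.eval_X, mul_comm]
  by_cases hd : d ∈ Finset.range (F.totalDegree + 1)
  · simpa [p, Polynomial.finsetSum_coeff, Polynomial.coeff_C_mul, Polynomial.coeff_X_pow,
      Finset.mem_range.1 hd] using congrArg (Polynomial.coeff · d) hp
  · rw [homogeneousComponent_eq_zero _ _ (by simpa using hd), map_zero]

theorem eval_smul_eq_zero_of_imClos {m n : ℕ} {b : Fin (n + 1) → Pl m} {H : Pl (n + 1)}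
    (h : ∀ (s : ℂ) (x), eval (s • fun i => eval x (b i)) H = 0) (s : ℂ)
    {u : Fin (n + 1) → ℂ} (hu : u ∈ cone (imClos b)) : eval (s • u) H = 0 := by
  rw [← sum_homogeneousComponent H, map_sum]
  refine Finset.sum_eq_zero fun d _ => ?_
  have hd := homogeneousComponent_isHomogeneous d H
  rw [eval_smul_of_isHomogeneous hd, eval_eq_zero_of_imClos hd (fun x =>
    eval_homogeneousComponent_eq_zero (fun s => h s x) d) hu, mul_zero]

theorem eval_shift {n : ℕ} (a u : Fin n → ℂ) (F : Pl n) : eval u (shift a F) = eval (a + u) F := by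
  have : (aeval u : Pl n →ₐ[ℂ] ℂ).comp (shift a) = aeval (a + u) := by
    ext i
    simp [shift]
  simpa [aeval_eq_eval] using DFunLike.congr_fun this F

theorem exists_eval_add_eq_zero {m n : ℕ} (hmn : m + m < n) (b : Fin n → Pl m) :
    ∃ G : Pl n, G ≠ 0 ∧ ∀ p q, eval ((fun i => eval p (b i)) + fun i => eval q (b i)) G = 0 := by
  let B : Fin n → MvPolynomial (Fin m ⊕ Fin m) ℂ :=
    fun i => rename Sum.inl (b i) + rename Sum.inr (b i)
  have hB : ¬ AlgebraicIndependent ℂ B := fun hB => by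
    have := hB.cardinalMk_le_trdeg
    rw [MvPolynomial.trdeg_of_isDomain] at this
    simp only [Cardinal.mk_fin, Cardinal.mk_sum, Cardinal.lift_id] at this
    exact hmn.not_ge (by exact_mod_cast this)
  rw [algebraicIndependent_iff] at hB
  push Not at hB
  obtain ⟨G, hG, hG0⟩ := hB
  refine ⟨G, hG0, fun p q => ?_⟩
  have : (aeval (Sum.elim p q)).comp (aeval B) =
      (aeval ((fun i => eval p (b i)) + fun i => eval q (b i)) : Pl n →ₐ[ℂ] ℂ) := by
    ext i
    simp [B, ← aeval_eq_eval, aeval_rename]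
  have := DFunLike.congr_fun this G
  rw [AlgHom.comp_apply, hG, map_zero, aeval_eq_eval] at this
  exact this.symm

theorem exists_secantVariety_eval_eq_zero {m n d : ℕ} (hmn : m + m < n + 1) (hd : d ≠ 0)
    {b : Fin (n + 1) → Pl m} (hb : ∀ i, (b i).IsHomogeneous d) :
    ∃ (G : Pl (n + 1)) (e : ℕ), G ≠ 0 ∧ G.IsHomogeneous e ∧
      ∀ v ∈ cone (secantVariety (imClos b)), eval v G = 0 := by
  obtain ⟨G, hG, hG'⟩ := exists_eval_add_eq_zero hmn b
  have hs (s : ℂ) (p : Fin m → ℂ) : ∃ p', (s • fun i => eval p (b i)) = fun i => eval p' (b i) := by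
    obtain ⟨r, rfl⟩ := IsAlgClosed.exists_pow_nat_eq s (Nat.pos_of_ne_zero hd)
    exact ⟨r • p, by ext i; simp [eval_smul_of_isHomogeneous (hb i)]⟩
  have h1 (s t : ℂ) (p) {u} (hu : u ∈ cone (imClos b)) :
      eval ((s • fun i => eval p (b i)) + t • u) G = 0 := by
    rw [← eval_shift]
    refine eval_smul_eq_zero_of_imClos (fun t q => ?_) t hu
    obtain ⟨p', hp⟩ := hs s p
    obtain ⟨q', hq⟩ := hs t q
    rw [eval_shift, hp, hq, hG']
  have h2 (s t : ℂ) {u v} (hu : u ∈ cone (imClos b)) (hv : v ∈ cone (imClos b)) :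
      eval (s • u + t • v) G = 0 := by
    rw [add_comm (s • u), ← eval_shift]
    refine eval_smul_eq_zero_of_imClos (fun s p => ?_) s hu
    rw [eval_shift, add_comm (t • v), h1 _ _ _ hv]
  obtain ⟨e, he⟩ : ∃ e, homogeneousComponent e G ≠ 0 := by
    by_contra! h
    exact hG (by rw [← sum_homogeneousComponent G]; simp [h])
  have hh := homogeneousComponent_isHomogeneous e G
  refine ⟨_, e, he, hh, fun v hv => eval_eq_zero_of_mk_mem hh ?_ hv⟩
  rintro y ⟨u, v, hu, hv, hy⟩
  refine ⟨y.rep, y.rep_nonzero, y.mk_rep, eval_homogeneousComponent_eq_zero (fun r => ?_) e⟩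
  obtain ⟨s, t, h⟩ := Submodule.mem_span_pair.1 hy
  rw [← h, smul_add, smul_smul, smul_smul]
  exact h2 _ _ hu hv

/-! ## STATEMENT 4
For a general surface `S₁₄ ⊆ ℙ⁵` (a general isomorphic projection to `ℙ⁵` of
the degree-8, sectional genus-3 smooth surface in `ℙ⁶` that is the image of
`ℙ²` under quartic plane curves with 8 general base points), the space
`H⁰(𝐼²_{S₁₄}(5))` of quintic forms vanishing to order `≥ 2` along `S₁₄` has
dimension 5, so `|H⁰(𝐼²_{S₁₄}(5))| = ℙ⁴`. -/
theorem h0_quintics_double_along_S14 :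
    GenericAff (ι := Fin 8 × Fin 3) fun P =>
      ∀ b : Fin 7 → Pl 3,
        IsBasisOf b (linSysV 3 4 1 (Set.range fun i : Fin 8 => fun j => P (i, j))) →
        GenericAff (ι := Fin 7) fun w =>
          ∀ L : (Fin 7 → ℂ) →ₗ[ℂ] (Fin 6 → ℂ), Function.Surjective L →
            LinearMap.ker L = Submodule.span ℂ {w} →
            (∀ v ∈ cone (secantVariety (imClos (n := 6) b)), L v ≠ 0) ∧
            h0 5 2 (projIm L (imClos (n := 6) b)) = 5 := by
  refine ⟨genericity X fun k => C (ctr k : ℂ), fun h => genericity_complex_ne_zero ?_, ?_⟩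
  · have := congrArg (eval fun v => (pts v : ℂ)) h
    rw [map_genericity, map_zero] at this
    simpa [Function.comp_def] using this
  intro P hP b hb
  have hP' : genericity P (fun k => (ctr k : ℂ)) ≠ 0 := by
    rw [map_genericity] at hP
    simpa [Function.comp_def] using hP
  have hdet : (quartMat P).det ≠ 0 := by
    simp only [genericity, mul_ne_zero_iff] at hP'
    exact hP'.1.1.1.1
  obtain ⟨h, hh, hq⟩ := exists_quartPoly_eq hdet hb
  obtain ⟨G, e, hG, hGe, hsec⟩ := exists_secantVariety_eval_eq_zero (by norm_num) four_ne_zero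
    fun i => (hb.1 i).1
  have hgen (w : Fin 7 → ℂ) : eval w (genericity (fun v => C (P v)) fun k => ∑ l, C (h k l) * X l) =
      genericity P (h.mulVec w) := by
    rw [map_genericity]
    congr 1
    · ext v
      simp
    · ext k
      simp [Matrix.mulVec, dotProduct]
  refine ⟨genericity (fun v => C (P v)) (fun k => ∑ l, C (h k l) * X l) * G,
    mul_ne_zero (fun h0 => hP' ?_) hG, fun w hw L hL hker => ?_⟩
  · have := hgen (h⁻¹.mulVec fun k => (ctr k : ℂ))
    rwa [h0, map_zero, Matrix.mulVec_mulVec, Matrix.mul_nonsing_inv _ hh.isUnit,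
      Matrix.one_mulVec, eq_comm] at this
  rw [map_mul, hgen, mul_ne_zero_iff] at hw
  refine ⟨fun v hv hLv => ?_, h0_projIm_eq_five hh hq hw.1 hL hker⟩
  obtain ⟨c, rfl⟩ := Submodule.mem_span_singleton.1 (hker ▸ LinearMap.mem_ker.2 hLv)
  have hc : c ≠ 0 := fun hc => hv.1 (by rw [hc, zero_smul])
  have := hsec _ hv
  rw [eval_smul_of_isHomogeneous hGe] at this
  exact hw.2 ((mul_eq_zero.1 this).resolve_left (pow_ne_zero e hc))

end CF
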